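/- arXiv:2205.04254 — 2 statements merged into one kernel-verified Lean document; each statement's English description precedes it below -/
import Mathlib

section
/- Let f, g_1, …, g_m ∈ ℝ[x] with g = (g_1,…,g_m), and assume f is non-negative on S(g). Let U_1, …, U_r ⊂ ℂⁿ be pairwise disjoint complex varieties, each defined by finitely many polynomials with real coefficients, and set U = U_1 ∪ … ∪ U_r. Assume f is constant on each U_i. Then there exists q ∈ P(g)[x] such that f − q vanishes on U ∩ ℝⁿ. Moreover, if S(g) satisfies the Archimedean condition, one can take q ∈ Q(g)[x]. -/
open MvPolynomial

noncomputable section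

/-- `p` is a sum of squares of polynomials. -/
def IsSOS {σ : Type*} (p : MvPolynomial σ ℝ) : Prop :=
  ∃ (k : ℕ) (q : Fin k → MvPolynomial σ ℝ), p = ∑ i, q i ^ 2

/-- Membership in the quadratic module `Q(g)` generated by the tuple `g`. -/
def InQM {σ ι : Type*} [Fintype ι] (g : ι → MvPolynomial σ ℝ) (p : MvPolynomial σ ℝ) : Prop :=
  ∃ (s0 : MvPolynomial σ ℝ) (s : ι → MvPolynomial σ ℝ),
    IsSOS s0 ∧ (∀ j, IsSOS (s j)) ∧ p = s0 + ∑ j, s j * g j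

/-- Membership in the preordering `P(g)` generated by the tuple `g`. -/
def InPre {σ ι : Type*} [Fintype ι] [DecidableEq ι] (g : ι → MvPolynomial σ ℝ)
    (p : MvPolynomial σ ℝ) : Prop :=
  ∃ s : Finset ι → MvPolynomial σ ℝ, (∀ A, IsSOS (s A)) ∧
    p = ∑ A : Finset ι, s A * ∏ j ∈ A, g j

/-- The basic semi-algebraic set `S(g)`. -/
def Sg {n m : ℕ} (g : Fin m → MvPolynomial (Fin n) ℝ) : Set (Fin n → ℝ) :=
  {x | ∀ j, 0 ≤ eval x (g j)}

/-- `S(g)` satisfies the Archimedean condition. -/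
def ArchCond {n m : ℕ} (g : Fin m → MvPolynomial (Fin n) ℝ) : Prop :=
  ∃ R : ℝ, 0 < R ∧ InQM g (C R - ∑ i : Fin n, X i ^ 2)

/-- Evaluation of a real polynomial at a complex point, via the canonical extension. -/
def evalC {n : ℕ} (f : MvPolynomial (Fin n) ℝ) (z : Fin n → ℂ) : ℂ :=
  eval z (map (algebraMap ℝ ℂ) f)

/-- `W ⊆ ℂⁿ` is a complex variety defined by finitely many polynomials with real
coefficients. -/
def IsRealVariety {n : ℕ} (W : Set (Fin n → ℂ)) : Prop :=
  ∃ (l : ℕ) (h : Fin l → MvPolynomial (Fin n) ℝ), W = {z | ∀ t, evalC (h t) z = 0}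

/-- The intermediate value property for polynomials over an ordered field. Among ordered fields
this characterises the real closed ones. -/
def PolyIVT (F : Type*) [Field F] [LinearOrder F] : Prop :=
  ∀ (p : Polynomial F) (a b : F), a < b → p.eval a < 0 → 0 < p.eval b →
    ∃ c, a < c ∧ c < b ∧ p.eval c = 0

namespace PolyIVT

open Polynomial hiding C X

variable {F : Type*} [Field F] [LinearOrder F] [IsStrictOrderedRing F]

theorem exists_root_of_mul_neg (hF : PolyIVT F) (p : F[X]) {a b : F} (hab : a < b)
    (h : p.eval a * p.eval b < 0) : ∃ c, a < c ∧ c < b ∧ p.eval c = 0 := by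
  rcases mul_neg_iff.1 h with ⟨h1, h2⟩ | ⟨h1, h2⟩
  · obtain ⟨c, hac, hcb, hc⟩ := hF (-p) a b hab (by simpa using h1) (by simpa using h2)
    exact ⟨c, hac, hcb, by simpa using hc⟩
  · exact hF p a b hab h1 h2

theorem sign_eval_eq (hF : PolyIVT F) (p : F[X]) {a b : F} (hab : a ≤ b)
    (h : ∀ c, a ≤ c → c ≤ b → p.eval c ≠ 0) :
    SignType.sign (p.eval a) = SignType.sign (p.eval b) := by
  rcases hab.eq_or_lt with rfl | hab
  · rfl
  have ha := h a le_rfl hab.le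
  have hb := h b hab.le le_rfl
  by_contra hne
  have hneg : p.eval a * p.eval b < 0 := by
    rcases ha.lt_or_gt with ha | ha <;> rcases hb.lt_or_gt with hb | hb
    · simp [sign_neg ha, sign_neg hb] at hne
    · exact mul_neg_of_neg_of_pos ha hb
    · exact mul_neg_of_pos_of_neg ha hb
    · simp [sign_pos ha, sign_pos hb] at hne
  obtain ⟨c, hac, hcb, hc⟩ := hF.exists_root_of_mul_neg p hab hneg
  exact h c hac.le hcb.le hc

theorem sign_eval_eq_of_no_root (hF : PolyIVT F) (p : F[X]) (h : ∀ c, p.eval c ≠ 0) (a b : F) :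
    SignType.sign (p.eval a) = SignType.sign (p.eval b) := by
  rcases le_total a b with hab | hab
  · exact hF.sign_eval_eq p hab fun c _ _ => h c
  · exact (hF.sign_eval_eq p hab fun c _ _ => h c).symm

/-- Rolle's theorem for polynomials. -/
theorem exists_derivative_root (hF : PolyIVT F) (p : F[X]) {a b : F} (hab : a < b)
    (ha : p.eval a = 0) (hb : p.eval b = 0) :
    ∃ c, a < c ∧ c < b ∧ p.derivative.eval c = 0 := by
  classical
  by_cases hp : p = 0
  · obtain ⟨c, h1, h2⟩ := exists_between hab
    exact ⟨c, h1, h2, by simp [hp]⟩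
  set S := p.roots.toFinset.filter (fun c => a < c ∧ c ≤ b) with hS
  have hmem : ∀ c, c ∈ S ↔ p.eval c = 0 ∧ a < c ∧ c ≤ b := by
    intro c; simp [hS, hp]
  have hne : S.Nonempty := ⟨b, (hmem b).2 ⟨hb, hab, le_rfl⟩⟩
  obtain ⟨hb0, hab', hbb⟩ := (hmem _).1 (S.min'_mem hne)
  set b' := S.min' hne
  have hmin : ∀ c, a < c → c < b' → p.eval c ≠ 0 := fun c h1 h2 h0 =>
    (S.min'_le c ((hmem c).2 ⟨h0, h1, h2.le.trans hbb⟩)).not_gt h2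
  obtain ⟨q, hq, hqa⟩ := exists_eq_pow_rootMultiplicity_mul_and_not_dvd p hp a
  have hq0 : q ≠ 0 := by rintro rfl; simp at hqa
  have hm : 0 < p.rootMultiplicity a := (rootMultiplicity_pos hp).2 ha
  obtain ⟨m, hm⟩ := Nat.exists_eq_add_of_lt hm
  obtain ⟨s, hs, hsb⟩ := exists_eq_pow_rootMultiplicity_mul_and_not_dvd q hq0 b'
  have hqb : q.eval b' = 0 := by
    have h0 := hb0
    rw [hq] at h0
    simpa [sub_ne_zero.2 hab'.ne'] using h0
  have hn : 0 < q.rootMultiplicity b' := (rootMultiplicity_pos hq0).2 hqb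
  obtain ⟨n, hn⟩ := Nat.exists_eq_add_of_lt hn
  rw [hn] at hs
  rw [hm] at hq
  simp only [zero_add] at hs hq
  rw [dvd_iff_isRoot, IsRoot.def] at hqa hsb
  rw [hs] at hq
  have hsa : s.eval a ≠ 0 := by
    intro h0; apply hqa; rw [hs]; simp [h0]
  have hsc : ∀ c, a ≤ c → c ≤ b' → s.eval c ≠ 0 := by
    intro c h1 h2 h0
    rcases h1.eq_or_lt with rfl | h1
    · exact hsa h0
    rcases h2.eq_or_lt with rfl | h2
    · exact hsb h0
    exact hmin c h1 h2 (by rw [hq]; simp [h0])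
  have hsign := hF.sign_eval_eq s hab'.le hsc
  set t : F[X] := Polynomial.C ((m : F) + 1) * (Polynomial.X - Polynomial.C b') * s +
    Polynomial.C ((n : F) + 1) * (Polynomial.X - Polynomial.C a) * s +
    (Polynomial.X - Polynomial.C a) * (Polynomial.X - Polynomial.C b') * derivative s with ht
  have hder : derivative p = (Polynomial.X - Polynomial.C a) ^ m *
      (Polynomial.X - Polynomial.C b') ^ n * t := by
    rw [hq, ht]
    simp only [derivative_mul, derivative_pow, derivative_sub, derivative_X, derivative_C, map_add,
      map_natCast, map_one, Nat.add_sub_cancel, Nat.cast_add, Nat.cast_one]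
    ring
  have hneg : t.eval a * t.eval b' < 0 := by
    have hprod : 0 < s.eval a * s.eval b' := by
      rcases hsa.lt_or_gt with h | h
      · rw [sign_neg h, eq_comm, sign_eq_neg_one_iff] at hsign
        exact mul_pos_of_neg_of_neg h hsign
      · rw [sign_pos h, eq_comm, sign_eq_one_iff] at hsign
        exact mul_pos h hsign
    have : t.eval a * t.eval b' =
        -(((m : F) + 1) * ((n : F) + 1) * (b' - a) ^ 2 * (s.eval a * s.eval b')) := by
      simp [ht]; ring
    rw [this, neg_lt_zero]
    have := sub_pos.2 hab'
    positivity
  obtain ⟨c, h1, h2, h3⟩ := hF.exists_root_of_mul_neg t hab' hneg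
  exact ⟨c, h1, h2.trans_le hbb, by rw [hder]; simp [h3]⟩

/-- Near a simple root isolated by the derivative, a polynomial changes sign exactly once. -/
theorem exists_sign_eval_eq (hF : PolyIVT F) (p : F[X]) {a x b : F} (hax : a < x) (hxb : x < b)
    (hx : p.eval x = 0) (h : ∀ c, a < c → c < b → p.derivative.eval c ≠ 0) :
    ∃ e : SignType, e * e = 1 ∧ ∀ c, a ≤ c → c ≤ b →
      SignType.sign (p.eval c) = SignType.sign (c - x) * e := by
  obtain ⟨s, rfl⟩ := dvd_iff_isRoot.2 (show p.IsRoot x from hx)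
  have hs : ∀ c, a ≤ c → c ≤ b → s.eval c ≠ 0 := by
    intro c h1 h2 h0
    rcases lt_trichotomy c x with hcx | rfl | hcx
    · obtain ⟨d, hd1, hd2, hd⟩ := hF.exists_derivative_root
        ((Polynomial.X - Polynomial.C x) * s) hcx (by simp [h0])
        (by simp)
      exact h d (h1.trans_lt hd1) (hd2.trans hxb) hd
    · exact h c hax hxb (by simp [derivative_mul, h0])
    · obtain ⟨d, hd1, hd2, hd⟩ := hF.exists_derivative_root
        ((Polynomial.X - Polynomial.C x) * s) hcx (by simp)
        (by simp [h0])
      exact h d (hax.trans hd1) (hd2.trans_le h2) hd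
  refine ⟨SignType.sign (s.eval x), ?_, fun c h1 h2 => ?_⟩
  · rcases (hs x hax.le hxb.le).lt_or_gt with h | h
    · simp [sign_neg h]
    · simp [sign_pos h]
  · have : SignType.sign (s.eval c) = SignType.sign (s.eval x) := by
      rcases le_total c x with hc | hc
      · exact hF.sign_eval_eq s hc fun d hd1 hd2 => hs d (h1.trans hd1) (hd2.trans hxb.le)
      · exact (hF.sign_eval_eq s hc fun d hd1 hd2 => hs d (hax.le.trans hd1) (hd2.trans h2)).symm
    rw [Polynomial.eval_mul, sign_mul, this]
    simp

end PolyIVT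

theorem polyIVT_real : PolyIVT ℝ := by
  intro p a b hab ha hb
  obtain ⟨c, hc, h0⟩ := intermediate_value_Ioo hab.le p.continuous.continuousOn ⟨ha, hb⟩
  exact ⟨c, hc.1, hc.2, h0⟩

/-- The neighbours of a point in a finite subset of a linear order. -/
theorem Finset.exists_neighbors {α : Type*} [LinearOrder α] (S : Finset α) (x : α) (hx : x ∉ S)
    (hlo : ∃ a ∈ S, a < x) (hhi : ∃ b ∈ S, x < b) :
    ∃ a ∈ S, ∃ b ∈ S, a < x ∧ x < b ∧ ∀ c ∈ S, a < c → c < b → False := by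
  have h1 : (S.filter (· < x)).Nonempty := by
    obtain ⟨a, ha, h⟩ := hlo; exact ⟨a, by simp [ha, h]⟩
  have h2 : (S.filter (x < ·)).Nonempty := by
    obtain ⟨a, ha, h⟩ := hhi; exact ⟨a, by simp [ha, h]⟩
  have m1 := Finset.mem_filter.1 (Finset.max'_mem _ h1)
  have m2 := Finset.mem_filter.1 (Finset.min'_mem _ h2)
  refine ⟨_, m1.1, _, m2.1, m1.2, m2.2, fun c hc hac hcb => ?_⟩
  rcases lt_trichotomy c x with h | rfl | h
  · exact (Finset.le_max' _ c (by simp [hc, h])).not_gt hac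
  · exact hx hc
  · exact (Finset.min'_le _ c (by simp [hc, h])).not_gt hcb

section SignTransfer

open Polynomial hiding C X

theorem sign_inv_eq {L : Type*} [Field L] [LinearOrder L] [IsStrictOrderedRing L] (a : L) :
    SignType.sign a⁻¹ = SignType.sign a := by
  rcases lt_trichotomy a 0 with h | rfl | h
  · rw [sign_neg h, sign_neg (inv_lt_zero.2 h)]
  · simp
  · rw [sign_pos h, sign_pos (inv_pos.2 h)]

theorem Polynomial.Monic.abs_root_lt {L : Type*} [Field L] [LinearOrder L] [IsStrictOrderedRing L]
    {p : L[X]} (hp : p.Monic) {x : L} (hx : p.eval x = 0) :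
    |x| < 1 + ∑ i ∈ Finset.range p.natDegree, |p.coeff i| := by
  by_contra! h
  set S := ∑ i ∈ Finset.range p.natDegree, |p.coeff i| with hS
  have hS0 : 0 ≤ S := Finset.sum_nonneg fun i _ => abs_nonneg _
  have h1 : 1 ≤ |x| := by linarith
  have hev := hx
  rw [eval_eq_sum_range, Finset.sum_range_succ, hp.coeff_natDegree, one_mul] at hev
  rcases Nat.eq_zero_or_eq_succ_pred p.natDegree with h0 | h0
  · simp [h0] at hev
  set e := p.natDegree.pred
  have hle : |x| ^ p.natDegree ≤ S * |x| ^ e := by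
    calc |x| ^ p.natDegree = |∑ i ∈ Finset.range p.natDegree, p.coeff i * x ^ i| := by
          rw [← abs_pow, ← abs_neg, neg_eq_of_add_eq_zero_left hev]
      _ ≤ ∑ i ∈ Finset.range p.natDegree, |p.coeff i * x ^ i| := Finset.abs_sum_le_sum_abs _ _
      _ ≤ ∑ i ∈ Finset.range p.natDegree, |p.coeff i| * |x| ^ e := by
          refine Finset.sum_le_sum fun i hi => ?_
          rw [abs_mul, abs_pow]
          refine mul_le_mul_of_nonneg_left (pow_le_pow_right₀ h1 ?_) (abs_nonneg _)
          rw [Finset.mem_range, h0] at hi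
          lia
      _ = S * |x| ^ e := by rw [hS, Finset.sum_mul]
  rw [h0, pow_succ', mul_comm S, mul_comm |x|] at hle
  have := le_of_mul_le_mul_left hle (by positivity)
  linarith

variable {k L M : Type*} [CommRing k] [Field L] [LinearOrder L] [Field M] [LinearOrder M]

/-- Two embeddings of a ring into ordered fields induce the same order. -/
structure SignCompat (f : k →+* L) (g : k →+* M) : Prop where
  injective : Function.Injective f
  sign_eq : ∀ a, SignType.sign (f a) = SignType.sign (g a)

/-- The roots in `L` of polynomials over `k` of degree less than `d` come from `k`. -/
def RootsInRange (f : k →+* L) (d : ℕ) : Prop :=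
  ∀ p : k[X], p ≠ 0 → p.natDegree < d → ∀ x, p.eval₂ f x = 0 → ∃ a, f a = x

/-- `k` cannot be enlarged by a simple extension that is compatible with both orders. -/
def MaximalPair (f : k →+* L) (g : k →+* M) : Prop :=
  ∀ x y, (∀ p : k[X], SignType.sign (p.eval₂ f x) = SignType.sign (p.eval₂ g y)) →
    ∃ a, f a = x ∧ g a = y

variable {f : k →+* L} {g : k →+* M}

theorem SignCompat.symm (h : SignCompat f g) : SignCompat g f where
  injective := (injective_iff_map_eq_zero g).2 fun a ha =>
    (injective_iff_map_eq_zero f).1 h.injective a (by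
      rw [← sign_eq_zero_iff, h.sign_eq, ha, sign_zero])
  sign_eq a := (h.sign_eq a).symm

theorem MaximalPair.symm (h : MaximalPair f g) : MaximalPair g f := fun x y hxy => by
  obtain ⟨a, h1, h2⟩ := h y x fun p => (hxy p).symm
  exact ⟨a, h2, h1⟩

variable [IsStrictOrderedRing L] [IsStrictOrderedRing M]

namespace SignCompat

theorem lt_iff (h : SignCompat f g) (a b : k) : f a < f b ↔ g a < g b := by
  rw [← sub_pos, ← sub_pos (a := g b), ← map_sub, ← map_sub, ← sign_eq_one_iff, h.sign_eq,
    sign_eq_one_iff]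

theorem le_iff (h : SignCompat f g) (a b : k) : f a ≤ f b ↔ g a ≤ g b := by
  rw [← not_lt, h.lt_iff, not_lt]

/-- If low degree polynomials have no new roots, the sign of such a polynomial at a point is
determined by the cut of the point. -/
theorem sign_eval₂_eq (h : SignCompat f g) (hL : PolyIVT L) (hM : PolyIVT M) {d : ℕ}
    (hf : RootsInRange f d) (hg : RootsInRange g d) {x : L} {y : M}
    (hxy : ∀ a, SignType.sign (f a - x) = SignType.sign (g a - y)) (p : k[X])
    (hp : p.natDegree < d) :
    SignType.sign (p.eval₂ f x) = SignType.sign (p.eval₂ g y) := by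
  have : IsDomain k := h.injective.isDomain f
  induction hn : p.natDegree using Nat.strong_induction_on generalizing p with
  | _ n ih =>
  by_cases hp0 : p = 0
  · simp [hp0]
  by_cases hroot : ∃ a, p.IsRoot a
  · obtain ⟨a, ha⟩ := hroot
    obtain ⟨q, rfl⟩ := dvd_iff_isRoot.2 ha
    have hq0 : q ≠ 0 := by rintro rfl; simp at hp0
    have hdeg : ((Polynomial.X - Polynomial.C a) * q).natDegree = q.natDegree + 1 := by
      rw [natDegree_mul (X_sub_C_ne_zero a) hq0, natDegree_X_sub_C, add_comm]
    have hq := ih q.natDegree (by lia) q (by lia) rfl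
    have hneg : SignType.sign (x - f a) = SignType.sign (y - g a) := by
      rw [← neg_sub, ← neg_sub (g a), Left.sign_neg, Left.sign_neg, hxy]
    simp only [Polynomial.eval₂_mul, sign_mul, hq, Polynomial.eval₂_sub, Polynomial.eval₂_X,
      Polynomial.eval₂_C, hneg]
  · have key : ∀ a, p.eval a ≠ 0 := fun a ha => hroot ⟨a, ha⟩
    have h1 : ∀ c, (p.map f).eval c ≠ 0 := by
      intro c hc
      rw [Polynomial.eval_map] at hc
      obtain ⟨a, rfl⟩ := hf p hp0 hp c hc
      rw [eval₂_at_apply] at hc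
      exact key a ((injective_iff_map_eq_zero f).1 h.injective _ hc)
    have h2 : ∀ c, (p.map g).eval c ≠ 0 := by
      intro c hc
      rw [Polynomial.eval_map] at hc
      obtain ⟨a, rfl⟩ := hg p hp0 hp c hc
      rw [eval₂_at_apply] at hc
      exact key a ((injective_iff_map_eq_zero g).1 h.symm.injective _ hc)
    rw [← Polynomial.eval_map, ← Polynomial.eval_map, hL.sign_eval_eq_of_no_root _ h1 x (f 0),
      hM.sign_eval_eq_of_no_root _ h2 y (g 0), Polynomial.eval_map, Polynomial.eval_map, eval₂_at_apply,
      eval₂_at_apply,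
      h.sign_eq]

end SignCompat

namespace MaximalPair

theorem exists_inv (h : MaximalPair f g) (hs : SignCompat f g) {c : k} (hc : c ≠ 0) :
    ∃ c', f c' = (f c)⁻¹ ∧ c * c' = 1 := by
  have hfc : f c ≠ 0 := (map_ne_zero_iff f hs.injective).2 hc
  have hgc : g c ≠ 0 := (map_ne_zero_iff g hs.symm.injective).2 hc
  obtain ⟨c', h1, h2⟩ := h (f c)⁻¹ (g c)⁻¹ (by
    intro p
    have e1 : p.eval₂ f (f c)⁻¹ = f (p.reverse.eval c) * (f c)⁻¹ ^ p.natDegree := by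
      let _ : Invertible (f c)⁻¹ := ⟨f c, by simp [hfc], by simp [hfc]⟩
      rw [← eval₂_reverse_mul_pow f (f c)⁻¹ p, ← eval₂_at_apply, invOf_eq_inv, inv_inv]
    have e2 : p.eval₂ g (g c)⁻¹ = g (p.reverse.eval c) * (g c)⁻¹ ^ p.natDegree := by
      let _ : Invertible (g c)⁻¹ := ⟨g c, by simp [hgc], by simp [hgc]⟩
      rw [← eval₂_reverse_mul_pow g (g c)⁻¹ p, ← eval₂_at_apply, invOf_eq_inv, inv_inv]
    have e3 : SignType.sign (f c)⁻¹ = SignType.sign (g c)⁻¹ := by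
      rw [sign_inv_eq, sign_inv_eq, hs.sign_eq]
    rw [e1, e2, sign_mul, sign_mul, sign_pow, sign_pow, hs.sign_eq, e3])
  exact ⟨c', h1, hs.injective (by simp [h1, hfc])⟩

theorem rootsInRange_succ (h : MaximalPair f g) (hs : SignCompat f g) (hL : PolyIVT L)
    (hM : PolyIVT M) {d : ℕ} (hf : RootsInRange f d) (hg : RootsInRange g d) :
    RootsInRange f (d + 1) := by
  classical
  have : IsDomain k := hs.injective.isDomain f
  intro p₀ hp₀ hd x hx₀
  by_contra hxr
  have hdeg₀ : p₀.natDegree = d := by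
    by_contra hne
    exact hxr (hf p₀ hp₀ (by lia) x hx₀)
  obtain ⟨c', -, hc'⟩ := h.exists_inv hs (leadingCoeff_ne_zero.2 hp₀)
  obtain ⟨p, hp, hdeg, hx⟩ : ∃ p : k[X], p.Monic ∧ p.natDegree = d ∧ p.eval₂ f x = 0 := by
    refine ⟨p₀ * Polynomial.C c', ?_, ?_, by simp [hx₀]⟩
    · rw [Monic, leadingCoeff_mul, leadingCoeff_C, hc']
    · rw [natDegree_mul_C (right_ne_zero_of_mul_eq_one hc'), hdeg₀]
  have hd0 : d ≠ 0 := by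
    rintro rfl
    rw [hp.natDegree_eq_zero.1 hdeg] at hx
    simp at hx
  have : CharZero k := by
    refine ⟨fun a b hab => ?_⟩
    have := congrArg f hab
    simpa using this
  have hder0 : derivative p ≠ 0 := by
    intro h0
    exact hd0 (hdeg ▸ derivative_eq_zero.1 h0)
  have hderdeg : (derivative p).natDegree < d := hdeg ▸ natDegree_derivative_lt (hdeg ▸ hd0)
  have hpf := hp.map f
  set B : k := 1 + ∑ i ∈ Finset.range p.natDegree, (1 + p.coeff i ^ 2) with hB
  have hxB : |x| < f B := by
    refine (hpf.abs_root_lt (x := x) (by rwa [Polynomial.eval_map])).trans_le ?_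
    rw [hp.natDegree_map f, hB, map_add, map_one, map_sum]
    refine add_le_add_right (Finset.sum_le_sum fun i _ => ?_) _
    rw [Polynomial.coeff_map, map_add, map_one, map_pow, ← sq_abs]
    nlinarith [sq_nonneg (|f (p.coeff i)| - 1), abs_nonneg (f (p.coeff i))]
  have hderf : (derivative p).map f ≠ 0 := by
    rwa [Ne, Polynomial.map_eq_zero_iff hs.injective]
  set S : Finset L := insert (f (-B)) (insert (f B) ((derivative p).map f).roots.toFinset) with hS
  have hmem : ∀ c, c ∈ S ↔ c = f (-B) ∨ c = f B ∨ (derivative p).eval₂ f c = 0 := by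
    intro c
    simp [hS, hderf, Polynomial.eval_map]
  have hSr : ∀ c ∈ S, ∃ a, f a = c := by
    intro c hc
    rcases (hmem c).1 hc with rfl | rfl | h0
    · exact ⟨_, rfl⟩
    · exact ⟨_, rfl⟩
    · exact hf _ hder0 hderdeg c h0
  obtain ⟨_, ha, _, hb, hax, hxb, hab⟩ := S.exists_neighbors x
    (fun hx => hxr (hSr x hx))
    ⟨f (-B), (hmem _).2 (Or.inl rfl), by rw [map_neg]; exact (abs_lt.1 hxB).1⟩
    ⟨f B, (hmem _).2 (Or.inr (Or.inl rfl)), (abs_lt.1 hxB).2⟩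
  obtain ⟨a, rfl⟩ := hSr _ ha
  obtain ⟨b, rfl⟩ := hSr _ hb
  have hdL : ∀ c, f a < c → c < f b → (derivative (p.map f)).eval c ≠ 0 := by
    intro c h1 h2 h0
    rw [derivative_map, Polynomial.eval_map] at h0
    exact hab c ((hmem c).2 (Or.inr (Or.inr h0))) h1 h2
  have hdM : ∀ c, g a < c → c < g b → (derivative (p.map g)).eval c ≠ 0 := by
    intro c h1 h2 h0
    rw [derivative_map, Polynomial.eval_map] at h0
    obtain ⟨e, rfl⟩ := hg _ hder0 hderdeg c h0
    refine hdL (f e) ((hs.lt_iff _ _).2 h1) ((hs.lt_iff _ _).2 h2) ?_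
    rw [eval₂_at_apply, map_eq_zero_iff g hs.symm.injective] at h0
    rw [derivative_map, Polynomial.eval_map, eval₂_at_apply, h0, map_zero]
  obtain ⟨ε, hε, hsL⟩ := hL.exists_sign_eval_eq (p.map f) hax hxb (by rwa [Polynomial.eval_map]) hdL
  have habM : g a < g b := (hs.lt_iff _ _).1 (hax.trans hxb)
  have hpe : ∀ e, SignType.sign ((p.map g).eval (g e)) = SignType.sign ((p.map f).eval (f e)) := by
    intro e
    rw [Polynomial.eval_map, Polynomial.eval_map, eval₂_at_apply, eval₂_at_apply, hs.sign_eq]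
  have hsa : SignType.sign ((p.map g).eval (g a)) = -ε := by
    rw [hpe, hsL _ le_rfl (hax.trans hxb).le, sign_neg (sub_neg.2 hax), neg_one_mul]
  have hsb : SignType.sign ((p.map g).eval (g b)) = ε := by
    rw [hpe, hsL _ (hax.trans hxb).le le_rfl, sign_pos (sub_pos.2 hxb), one_mul]
  have hneg : (p.map g).eval (g a) * (p.map g).eval (g b) < 0 := by
    rw [← sign_eq_neg_one_iff, sign_mul, hsa, hsb]
    clear hsa hsb hsL
    revert ε
    decide
  obtain ⟨y, hay, hyb, hy⟩ := hM.exists_root_of_mul_neg _ habM hneg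
  obtain ⟨ε', -, hsM⟩ := hM.exists_sign_eval_eq (p.map g) hay hyb hy hdM
  have hεε : ε' = ε := by
    rw [← hsb, hsM _ habM.le le_rfl, sign_pos (sub_pos.2 hyb), one_mul]
  have hcut : ∀ e, SignType.sign (f e - x) = SignType.sign (g e - y) := by
    intro e
    rcases lt_or_ge (f e) (f a) with h1 | h1
    · rw [sign_neg (sub_neg.2 (h1.trans hax)),
        sign_neg (sub_neg.2 (((hs.lt_iff _ _).1 h1).trans hay))]
    rcases lt_or_ge (f b) (f e) with h2 | h2
    · rw [sign_pos (sub_pos.2 (hxb.trans h2)),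
        sign_pos (sub_pos.2 (hyb.trans ((hs.lt_iff _ _).1 h2)))]
    have e1 := hsL _ h1 h2
    have e2 := hsM _ ((hs.le_iff _ _).1 h1) ((hs.le_iff _ _).1 h2)
    rw [hpe, e1, hεε] at e2
    have e3 := congrArg (· * ε) e2
    simpa only [mul_assoc, hε, mul_one] using e3
  obtain ⟨a', ha', -⟩ := h x y (by
    intro q
    have e1 : q.eval₂ f x = (q %ₘ p).eval₂ f x := by
      conv_lhs => rw [← modByMonic_add_div q p]
      simp [Polynomial.eval₂_mul, hx]
    have e2 : q.eval₂ g y = (q %ₘ p).eval₂ g y := by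
      conv_lhs => rw [← modByMonic_add_div q p]
      rw [Polynomial.eval_map] at hy
      simp [Polynomial.eval₂_mul, hy]
    rw [e1, e2]
    refine hs.sign_eval₂_eq hL hM hf hg hcut _ ?_
    rw [← hdeg]
    refine natDegree_modByMonic_lt q hp ?_
    rintro rfl
    simp at hdeg
    exact hd0 hdeg.symm)
  exact hxr ⟨a', ha'⟩

theorem rootsInRange (h : MaximalPair f g) (hs : SignCompat f g) (hL : PolyIVT L)
    (hM : PolyIVT M) (d : ℕ) : RootsInRange f d ∧ RootsInRange g d := by
  induction d with
  | zero => exact ⟨fun _ _ h => absurd h (by simp), fun _ _ h => absurd h (by simp)⟩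
  | succ d ih =>
    exact ⟨h.rootsInRange_succ hs hL hM ih.1 ih.2,
      h.symm.rootsInRange_succ hs.symm hM hL ih.2 ih.1⟩

end MaximalPair

end SignTransfer

section Extension

open Polynomial hiding C X

theorem maximalPair_id {k L : Type*} [Field k] [LinearOrder k] [IsStrictOrderedRing k] [Field L]
    [LinearOrder L] [IsStrictOrderedRing L] (f : k →+* L) : MaximalPair f (RingHom.id k) := by
  intro x y h
  refine ⟨y, ?_, rfl⟩
  have := h (Polynomial.X - Polynomial.C y)
  simp only [Polynomial.eval₂_sub, Polynomial.eval₂_X, Polynomial.eval₂_C, RingHom.id_apply,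
    sub_self, sign_zero, sign_eq_zero_iff] at this
  exact (sub_eq_zero.1 this).symm

theorem MaximalPair.exists_subfield {k L M : Type*} [CommRing k] [Field L] [LinearOrder L]
    [IsStrictOrderedRing L] [Field M] [LinearOrder M] [IsStrictOrderedRing M]
    {f : k →+* L} {g : k →+* M} (h : MaximalPair f g) (hs : SignCompat f g) (hL : PolyIVT L)
    (hM : PolyIVT M) : ∃ E : Subfield L, (∀ x, x ∈ E ↔ ∃ a, f a = x) ∧ PolyIVT E := by
  let E : Subfield L :=
    { f.range with
      inv_mem' := by
        rintro _ ⟨a, rfl⟩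
        by_cases ha : a = 0
        · exact ⟨0, by simp [ha]⟩
        · obtain ⟨c, hc, -⟩ := h.exists_inv hs ha
          exact ⟨c, hc⟩ }
  refine ⟨E, fun x => Iff.rfl, ?_⟩
  intro p a b hab ha hb
  have hev : ∀ c : E, (p.map E.subtype).eval (c : L) = ((p.eval c : E) : L) := fun c => by
    rw [Polynomial.eval_map]; exact eval₂_at_apply E.subtype c
  have hp0 : p.map E.subtype ≠ 0 := by
    intro h0
    have := hev a
    rw [h0] at this
    simp only [Polynomial.eval_zero] at this
    exact ha.ne (Subtype.ext this.symm)
  obtain ⟨c, hac, hcb, hc⟩ := hL (p.map E.subtype) a b hab (by rw [hev]; exact ha)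
    (by rw [hev]; exact hb)
  obtain ⟨q, hq⟩ : ∃ q : k[X], q.map f = p.map E.subtype := by
    rw [← mem_lifts, lifts_iff_coeff_lifts]
    intro n
    rw [Polynomial.coeff_map]
    exact (p.coeff n).2
  have hq0 : q ≠ 0 := by
    rintro rfl
    exact hp0 (by simpa using hq.symm)
  rw [← hq, Polynomial.eval_map] at hc
  have hcE : c ∈ E := (h.rootsInRange hs hL hM (q.natDegree + 1)).1 q hq0 (Nat.lt_succ_self _) c hc
  refine ⟨⟨c, hcE⟩, hac, hcb, Subtype.ext ?_⟩
  rw [← hev, ← hq, Polynomial.eval_map]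
  exact hc

theorem exists_maximalPair {L M : Type*} [Field L] [LinearOrder L] [Field M] [LinearOrder M]
    (R₀ : Subring (L × M)) (hR₀ : ∀ z ∈ R₀, SignType.sign z.1 = SignType.sign z.2) :
    ∃ R : Subring (L × M), R₀ ≤ R ∧
      SignCompat ((RingHom.fst L M).comp R.subtype) ((RingHom.snd L M).comp R.subtype) ∧
      MaximalPair ((RingHom.fst L M).comp R.subtype) ((RingHom.snd L M).comp R.subtype) := by
  obtain ⟨R, hle, hR⟩ := zorn_le_nonempty₀
    {R : Subring (L × M) | ∀ z ∈ R, SignType.sign z.1 = SignType.sign z.2}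
    (fun c hc hchain y hy => by
      refine ⟨sSup c, ?_, fun z hz => le_sSup hz⟩
      intro z hz
      rw [Subring.mem_sSup_of_directedOn ⟨y, hy⟩ hchain.directedOn] at hz
      obtain ⟨s, hs, hz⟩ := hz
      exact hc hs z hz) R₀ hR₀
  have hsign := hR.prop
  refine ⟨R, hle, ⟨(injective_iff_map_eq_zero _).2 fun a ha => ?_, fun a => hsign a a.2⟩, ?_⟩
  · have h2 := hsign a a.2
    have h1 : (a : L × M).1 = 0 := ha
    rw [h1, sign_zero, eq_comm, sign_eq_zero_iff] at h2
    exact Subtype.ext (Prod.ext h1 h2)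
  · intro x y hxy
    set f := (RingHom.fst L M).comp R.subtype
    set g := (RingHom.snd L M).comp R.subtype
    set φ : R[X] →+* L × M := (eval₂RingHom f x).prod (eval₂RingHom g y) with hφ
    have hRφ : R ≤ φ.range := fun z hz => ⟨Polynomial.C ⟨z, hz⟩, by simp [φ, f, g]⟩
    have hφR : φ.range ≤ R := hR.le_of_ge (by rintro _ ⟨p, rfl⟩; exact hxy p) hRφ
    have hmem : (x, y) ∈ R := hφR ⟨Polynomial.X, by simp [φ]⟩
    exact ⟨⟨(x, y), hmem⟩, rfl, rfl⟩

end Extension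

section Ultrapower

open Polynomial hiding C X
open Filter

variable {ι F : Type*} [Field F] [LinearOrder F] (U : Ultrafilter ι)

theorem eventually_sign_eq (s : ι → F) :
    ∀ᶠ i in (U : Filter ι), SignType.sign (s i) = SignType.sign (s : Germ (U : Filter ι) F) := by
  rcases lt_trichotomy (s : Germ (U : Filter ι) F) 0 with h | h | h
  · rw [sign_neg h]
    exact (Germ.coe_lt.1 h).mono fun i hi => sign_neg hi
  · rw [h, sign_zero]
    exact (Germ.coe_eq.1 h).mono fun i hi => by rw [hi]; simp
  · rw [sign_pos h]
    exact (Germ.coe_lt.1 h).mono fun i hi => sign_pos hi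

theorem polyIVT_germ (hF : PolyIVT F) : PolyIVT (Germ (U : Filter ι) F) := by
  set φ : (ι → F) →+* Germ (U : Filter ι) F := Germ.coeRingHom _ with hφ
  have hsurj : Function.Surjective φ := fun x => x.inductionOn fun s => ⟨s, rfl⟩
  intro p a b hab ha hb
  obtain ⟨p, rfl⟩ := Polynomial.map_surjective φ hsurj p
  obtain ⟨a, rfl⟩ := hsurj a
  obtain ⟨b, rfl⟩ := hsurj b
  rw [Polynomial.eval_map, eval₂_at_apply] at ha hb
  have hev : ∀ i (s : ι → F), p.eval s i = (p.map (Pi.evalRingHom _ i)).eval (s i) := by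
    intro i s
    rw [Polynomial.eval_map]
    exact (eval₂_at_apply (Pi.evalRingHom (fun _ : ι => F) i) s).symm
  have hroot : ∀ᶠ i in (U : Filter ι), ∃ c, a i < c ∧ c < b i ∧
      (p.map (Pi.evalRingHom _ i)).eval c = 0 := by
    filter_upwards [Germ.coe_lt.1 hab, Germ.coe_lt.1 ha, Germ.coe_lt.1 hb] with i h1 h2 h3
    exact hF _ _ _ h1 (by rw [← hev]; exact h2) (by rw [← hev]; exact h3)
  obtain ⟨c, hc⟩ := hroot.choice
  refine ⟨φ c, Germ.coe_lt.2 (hc.mono fun i h => h.1), Germ.coe_lt.2 (hc.mono fun i h => h.2.1), ?_⟩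
  rw [Polynomial.eval_map, eval₂_at_apply]
  exact Germ.coe_eq.2 (hc.mono fun i h => by rw [hev, h.2.2])

/-- An ultrafilter on a subfield converging to the cut of a point of the larger field. -/
theorem exists_ultrafilter_cut [IsStrictOrderedRing F] {L : Type*} [Field L]
    [LinearOrder L] [IsStrictOrderedRing L]
    (f : F →+* L) (hf : StrictMono f) (t : L) (ht : ∀ a, f a ≠ t) :
    ∃ U : Ultrafilter F, ∀ a, ∀ᶠ x in (U : Filter F),
      SignType.sign (a - x) = SignType.sign (f a - t) := by
  classical
  have hne : ∀ s : Finset F, ∃ x, ∀ a ∈ s, SignType.sign (a - x) = SignType.sign (f a - t) := by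
    intro s
    obtain ⟨x, h1, h2⟩ := Order.exists_between_finsets
      (lo := s.filter (fun a => f a < t)) (hi := s.filter (fun a => t < f a))
      (fun x hx y hy => hf.lt_iff_lt.1
        ((Finset.mem_filter.1 hx).2.trans (Finset.mem_filter.1 hy).2))
    refine ⟨x, fun a ha => ?_⟩
    rcases (ht a).lt_or_gt with h | h
    · rw [sign_neg (sub_neg.2 h), sign_neg (sub_neg.2 (h1 a (by simp [ha, h])))]
    · rw [sign_pos (sub_pos.2 h), sign_pos (sub_pos.2 (h2 a (by simp [ha, h])))]
  set l : Filter F := ⨅ s : Finset F,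
    𝓟 {x | ∀ a ∈ s, SignType.sign (a - x) = SignType.sign (f a - t)} with hl
  have : l.NeBot := by
    refine Filter.iInf_neBot_of_directed' ?_ fun s => principal_neBot_iff.2 (hne s)
    intro s s'
    refine ⟨s ∪ s', ?_, ?_⟩ <;>
    · refine Filter.principal_mono.2 fun x hx a ha => hx a (by simp [ha])
  refine ⟨Ultrafilter.of l, fun a => Ultrafilter.of_le l ?_⟩
  refine Filter.mem_iInf_of_mem {a} ?_
  rw [mem_principal]
  intro x hx
  exact hx a (by simp)

end Ultrapower

section ArtinLang

open Filter

/-- Finite systems of sign conditions over `F` that are solvable in `L` are solvable in `F`. -/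
def ReflectsSigns (σ : Type*) {F L : Type*} [Field F] [LinearOrder F] [Field L] [LinearOrder L]
    (i : F →+* L) : Prop :=
  ∀ (S : Finset (MvPolynomial σ F)) (x : σ → L), ∃ y : σ → F, ∀ p ∈ S,
    SignType.sign (eval y p) = SignType.sign (eval₂ i x p)

variable {L : Type*} [Field L] [LinearOrder L] [IsStrictOrderedRing L]

theorem exists_subfield_reflectsSigns (σ : Type*) (hL : PolyIVT L) (E₀ : Subfield L)
    (hE₀ : PolyIVT E₀) (t : L) :
    ∃ (E : Subfield L) (h : E₀ ≤ E), t ∈ E ∧ PolyIVT E ∧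
      ReflectsSigns σ (Subfield.inclusion h) := by
  by_cases ht : t ∈ E₀
  · refine ⟨E₀, le_rfl, ht, hE₀, fun S x => ⟨x, fun p _ => ?_⟩⟩
    rw [← eval₂_id]
    rfl
  have hf : StrictMono E₀.subtype := fun a b h => h
  obtain ⟨U, hU⟩ := exists_ultrafilter_cut E₀.subtype hf t
    (fun a ha => ht (ha ▸ a.2))
  set M := Germ (U : Filter E₀) E₀
  have hM : PolyIVT M := polyIVT_germ U hE₀
  set φ : (E₀ → E₀) →+* M := Germ.coeRingHom _ with hφ
  set g : E₀ →+* M := φ.comp (Pi.constRingHom E₀ E₀) with hg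
  have hsf : SignCompat E₀.subtype (RingHom.id E₀) :=
    ⟨E₀.subtype.injective, fun a => rfl⟩
  have hsg : SignCompat g (RingHom.id E₀) := by
    refine ⟨g.injective, fun a => ?_⟩
    obtain ⟨x, hx⟩ := (eventually_sign_eq U (fun _ : E₀ => a)).exists
    exact hx.symm
  have hs : SignCompat E₀.subtype g :=
    ⟨E₀.subtype.injective, fun a => (hsf.sign_eq a).trans (hsg.sign_eq a).symm⟩
  set s : M := φ id with hsdef
  have hcut : ∀ a, SignType.sign (E₀.subtype a - t) = SignType.sign (g a - s) := by
    intro a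
    obtain ⟨x, hx1, hx2⟩ := ((hU a).and (eventually_sign_eq U (fun x : E₀ => a - x))).exists
    rw [← hx1, hx2]
    rfl
  have hsign : ∀ p : Polynomial E₀, SignType.sign (p.eval₂ E₀.subtype t) =
      SignType.sign (p.eval₂ g s) := fun p =>
    hs.sign_eval₂_eq hL hM
      ((maximalPair_id _).rootsInRange hsf hL hE₀ (p.natDegree + 1)).1
      ((maximalPair_id _).rootsInRange hsg hM hE₀ (p.natDegree + 1)).1 hcut p (Nat.lt_succ_self _)
  set ψ : Polynomial E₀ →+* L × M :=
    (Polynomial.eval₂RingHom E₀.subtype t).prod (Polynomial.eval₂RingHom g s) with hψ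
  obtain ⟨R, hle, hRs, hRm⟩ := exists_maximalPair ψ.range
    (by rintro _ ⟨p, rfl⟩; exact hsign p)
  obtain ⟨E, hE, hEivt⟩ := hRm.exists_subfield hRs hL hM
  have hmem : ∀ a : E₀, ((a : L), g a) ∈ R := fun a => hle ⟨Polynomial.C a, by simp [ψ]⟩
  have h₀ : E₀ ≤ E := fun a ha => (hE a).2 ⟨⟨_, hmem ⟨a, ha⟩⟩, rfl⟩
  refine ⟨E, h₀, (hE t).2 ⟨⟨(t, s), hle ⟨Polynomial.X, by simp [ψ]⟩⟩, rfl⟩, hEivt, ?_⟩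
  intro S x
  have hz : ∀ i, ∃ z : R, (z : L × M).1 = x i := fun i => (hE _).1 (x i).2
  choose z hz using hz
  have hY : ∀ i, ∃ Y : E₀ → E₀, φ Y = (z i : L × M).2 := fun i =>
    Germ.inductionOn (z i : L × M).2 fun Y => ⟨Y, rfl⟩
  choose Y hY using hY
  set j : E₀ →+* R := (E₀.subtype.prod g).codRestrict R hmem with hj
  have hev : ∀ p : MvPolynomial σ E₀, SignType.sign (eval₂ (Subfield.inclusion h₀) x p) =
      SignType.sign (φ (eval₂ (Pi.constRingHom E₀ E₀) Y p)) := by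
    intro p
    have e1 : (RingHom.fst L M).comp R.subtype (eval₂ j z p) =
        (eval₂ (Subfield.inclusion h₀) x p : E) := by
      rw [eval₂_comp_left]
      refine Eq.trans ?_ (eval₂_comp_left E.subtype (Subfield.inclusion h₀) x p).symm
      congr 1
      exact funext hz
    have e2 : (RingHom.snd L M).comp R.subtype (eval₂ j z p) =
        φ (eval₂ (Pi.constRingHom E₀ E₀) Y p) := by
      rw [eval₂_comp_left, eval₂_comp_left]
      congr 1
      exact (funext hY).symm
    rw [← e2, ← hRs.sign_eq, e1]
    rfl
  have hall : ∀ᶠ ω in (U : Filter E₀), ∀ p ∈ S,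
      SignType.sign (eval₂ (Pi.constRingHom E₀ E₀) Y p ω) =
        SignType.sign (φ (eval₂ (Pi.constRingHom E₀ E₀) Y p)) :=
    (Filter.eventually_all_finset S).2 fun p _ => eventually_sign_eq U _
  obtain ⟨ω, hω⟩ := hall.exists
  refine ⟨fun i => Y i ω, fun p hp => ?_⟩
  have : eval (fun i => Y i ω) p = eval₂ (Pi.constRingHom E₀ E₀) Y p ω := by
    rw [← eval₂_id]
    exact (eval₂_comp_left (Pi.evalRingHom (fun _ : E₀ => E₀) ω) (Pi.constRingHom E₀ E₀) Y p).symm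
  rw [hev, ← hω p hp, this]

theorem ReflectsSigns.comp {σ F K L : Type*} [Field F] [LinearOrder F] [Field K] [LinearOrder K]
    [Field L] [LinearOrder L] {i : F →+* K} {j : K →+* L} (hi : ReflectsSigns σ i)
    (hj : ReflectsSigns σ j) : ReflectsSigns σ (j.comp i) := by
  classical
  intro S x
  obtain ⟨y, hy⟩ := hj (S.image (map i)) x
  obtain ⟨w, hw⟩ := hi S y
  refine ⟨w, fun p hp => ?_⟩
  rw [hw p hp, ← eval_map, hy _ (Finset.mem_image_of_mem _ hp), eval₂_map]

/-- The Artin–Lang theorem for real closed fields. -/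
theorem reflectsSigns_of_polyIVT (n : ℕ) (hL : PolyIVT L) {F : Type*} [Field F] [LinearOrder F]
    [IsStrictOrderedRing F] (hF : PolyIVT F) (i : F →+* L) (hi : StrictMono i) :
    ReflectsSigns (Fin n) i := by
  have hs : SignCompat i (RingHom.id F) := by
    refine ⟨hi.injective, fun a => ?_⟩
    rcases lt_trichotomy a 0 with h | rfl | h
    · rw [RingHom.id_apply, sign_neg h, sign_neg (by simpa using hi h)]
    · simp
    · rw [RingHom.id_apply, sign_pos h, sign_pos (by simpa using hi h)]
  obtain ⟨E₀, hE₀, hE₀ivt⟩ := (maximalPair_id i).exists_subfield hs hL hF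
  have hiE : ∀ a, i a ∈ E₀ := fun a => (hE₀ _).2 ⟨a, rfl⟩
  set i₀ : F →+* E₀ := i.codRestrict E₀ hiE
  have hi₀ : ReflectsSigns (Fin n) i₀ := by
    intro S x
    have hx : ∀ k, ∃ a, i₀ a = x k := fun k => by
      obtain ⟨a, ha⟩ := (hE₀ _).1 (x k).2
      exact ⟨a, Subtype.ext ha⟩
    choose y hy using hx
    refine ⟨y, fun p _ => ?_⟩
    have : eval₂ i₀ x p = i₀ (eval y p) := by
      rw [← eval₂_id, eval₂_comp_left]
      congr 1
      exact (funext hy).symm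
    rw [this]
    exact (hs.sign_eq _).symm
  have hchain : ∀ (s : Finset L), ∃ (E : Subfield L) (h : ∀ a, i a ∈ E), PolyIVT E ∧
      ReflectsSigns (Fin n) (i.codRestrict E h) ∧ ∀ t ∈ s, t ∈ E := by
    classical
    intro s
    induction s using Finset.induction_on with
    | empty => exact ⟨E₀, hiE, hE₀ivt, hi₀, by simp⟩
    | insert t s _ ih =>
      obtain ⟨E, h, hE, hr, hsE⟩ := ih
      obtain ⟨E', hle, ht, hE', hr'⟩ := exists_subfield_reflectsSigns (Fin n) hL E hE t
      refine ⟨E', fun a => hle (h a), hE', hr.comp hr', fun u hu => ?_⟩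
      rcases Finset.mem_insert.1 hu with rfl | hu
      · exact ht
      · exact hle (hsE u hu)
  classical
  intro S x
  obtain ⟨E, h, -, hr, hx⟩ := hchain (Finset.univ.image x)
  obtain ⟨y, hy⟩ := hr S fun k => ⟨x k, hx _ (by simp)⟩
  refine ⟨y, fun p hp => ?_⟩
  rw [hy p hp]
  have : (eval₂ (i.codRestrict E h) (fun k => ⟨x k, hx _ (by simp)⟩) p : E) = eval₂ i x p :=
    eval₂_comp_left E.subtype _ _ _
  rw [← this]
  rfl

end ArtinLang

section Orderings

variable {A : Type*} [CommRing A]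

namespace RingPreordering

theorem exists_adjoin (P : RingPreordering A) (a : A)
    (h : ∀ s ∈ P, ∀ t ∈ P, s + a * t ≠ -1) : ∃ Q : RingPreordering A, P ≤ Q ∧ a ∈ Q := by
  refine ⟨mk' {x | ∃ s ∈ P, ∃ t ∈ P, x = s + a * t} ?_ ?_ ?_ ?_, fun s hs => ?_, ?_⟩
  · rintro _ _ ⟨s, hs, t, ht, rfl⟩ ⟨s', hs', t', ht', rfl⟩
    exact ⟨s + s', add_mem hs hs', t + t', add_mem ht ht', by ring⟩
  · rintro _ _ ⟨s, hs, t, ht, rfl⟩ ⟨s', hs', t', ht', rfl⟩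
    exact ⟨s * s' + a * a * (t * t'),
      add_mem (mul_mem hs hs') (mul_mem (P.mul_self_mem a) (mul_mem ht ht')),
      s * t' + t * s', add_mem (mul_mem hs ht') (mul_mem ht hs'), by ring⟩
  · exact fun x => ⟨x * x, P.mul_self_mem x, 0, zero_mem P, by ring⟩
  · rintro ⟨s, hs, t, ht, h'⟩
    exact h s hs t ht h'.symm
  · exact ⟨s, hs, 0, zero_mem P, by ring⟩
  · exact ⟨0, zero_mem P, 1, one_mem P, by ring⟩

theorem exists_le_isOrdering (P : RingPreordering A) :
    ∃ Q : RingPreordering A, P ≤ Q ∧ Q.IsOrdering := by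
  obtain ⟨Q, hPQ, hQ⟩ := zorn_le_nonempty₀ (Set.univ : Set (RingPreordering A))
    (fun c _ hc y hy => by
      refine ⟨mk' {x | ∃ Q ∈ c, x ∈ Q} ?_ ?_ ?_ ?_, Set.mem_univ _, fun Q hQ x hx => ⟨Q, hQ, hx⟩⟩
      · rintro a b ⟨Q, hQ, ha⟩ ⟨Q', hQ', hb⟩
        rcases hc.total hQ hQ' with h | h
        · exact ⟨Q', hQ', add_mem (h ha) hb⟩
        · exact ⟨Q, hQ, add_mem ha (h hb)⟩
      · rintro a b ⟨Q, hQ, ha⟩ ⟨Q', hQ', hb⟩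
        rcases hc.total hQ hQ' with h | h
        · exact ⟨Q', hQ', mul_mem (h ha) hb⟩
        · exact ⟨Q, hQ, mul_mem ha (h hb)⟩
      · exact fun x => ⟨y, hy, y.mul_self_mem x⟩
      · rintro ⟨Q, -, h⟩
        exact Q.neg_one_notMem h) P (Set.mem_univ _)
  have key : ∀ a, a ∉ Q → ∃ s ∈ Q, ∃ t ∈ Q, s + a * t = -1 := by
    intro a ha
    by_contra! hcon
    obtain ⟨Q', hle, haQ⟩ := Q.exists_adjoin a hcon
    exact ha (hQ.le_of_ge (Set.mem_univ _) hle haQ)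
  have htot : HasMemOrNegMem Q := ⟨fun a => by
    by_contra! hcon
    obtain ⟨s, hs, t, ht, h1⟩ := key a hcon.1
    obtain ⟨s', hs', t', ht', h2⟩ := key (-a) hcon.2
    refine Q.neg_one_notMem ?_
    have : (-1 : A) = s + s' + s * s' + a * a * (t * t') := by
      linear_combination (-(1 : A) - s') * h1 + a * t * h2
    rw [this]
    exact add_mem (add_mem (add_mem hs hs') (mul_mem hs hs'))
      (mul_mem (Q.mul_self_mem a) (mul_mem ht ht'))⟩
  have hprime : ∀ a b, a ∉ Q → b ∉ Q → a * b ∉ Q.support := by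
    intro a b ha hb hab
    obtain ⟨s, hs, t, ht, h1⟩ := key a ha
    obtain ⟨s', hs', t', ht', h2⟩ := key b hb
    refine Q.neg_one_notMem ?_
    have : (-1 : A) = s + s' + s * s' + (-(a * b)) * (t * t') := by
      linear_combination (-(1 : A) - s') * h1 + a * t * h2
    rw [this]
    exact add_mem (add_mem (add_mem hs hs') (mul_mem hs hs')) (mul_mem hab.2 (mul_mem ht ht'))
  refine ⟨Q, hPQ, IsOrdering.mk' Q fun {a b} hab => ?_⟩
  by_contra! hcon
  have hsupp : ∀ x, x ∉ Q.support → ∃ y, y ∉ Q ∧ (y = x ∨ y = -x) := by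
    intro x hx
    rw [mem_support, not_and_or] at hx
    rcases hx with hx | hx
    · exact ⟨x, hx, Or.inl rfl⟩
    · exact ⟨-x, hx, Or.inr rfl⟩
  obtain ⟨x, hx, hxa⟩ := hsupp a hcon.1
  obtain ⟨y, hy, hyb⟩ := hsupp b hcon.2
  refine hprime x y hx hy ?_
  have hab' := Q.support.neg_mem hab
  rcases hxa with rfl | rfl <;> rcases hyb with rfl | rfl <;> simpa using hab

end RingPreordering

/-- The nonnegative elements for a total field ordering on a subfield. -/
structure RingCone.IsFieldOrdering {Ω : Type*} [Field Ω] (P : RingCone Ω) : Prop where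
  inv_mem : ∀ x ∈ P, x⁻¹ ∈ P
  sub_mem : ∀ x ∈ P, ∀ y ∈ P, x - y ∈ P ∨ y - x ∈ P

theorem RingPreordering.exists_ringCone {Ω : Type*} [Field Ω] (Q : RingPreordering A)
    [HasMemOrNegMem Q] (ι : A →+* Ω) (hker : ∀ a, ι a = 0 ↔ a ∈ Q.support) :
    ∃ P : RingCone Ω, P.IsFieldOrdering ∧ ∀ a ∈ Q, ι a ∈ P := by
  refine ⟨{ carrier := {x | ∃ a ∈ Q, ∃ b ∈ Q, ι b ≠ 0 ∧ x = ι a / ι b}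
            zero_mem' := ⟨0, zero_mem Q, 1, one_mem Q, by simp, by simp⟩
            one_mem' := ⟨1, one_mem Q, 1, one_mem Q, by simp, by simp⟩
            add_mem' := ?_
            mul_mem' := ?_
            eq_zero_of_mem_of_neg_mem' := ?_ }, ⟨?_, ?_⟩, ?_⟩
  · rintro _ _ ⟨a, ha, b, hb, hb0, rfl⟩ ⟨c, hc, d, hd, hd0, rfl⟩
    refine ⟨a * c, mul_mem ha hc, b * d, mul_mem hb hd, ?_, ?_⟩
    · simp [hb0, hd0]
    · simp only [map_mul]; field_simp
  · rintro _ _ ⟨a, ha, b, hb, hb0, rfl⟩ ⟨c, hc, d, hd, hd0, rfl⟩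
    refine ⟨a * d + c * b, add_mem (mul_mem ha hd) (mul_mem hc hb), b * d, mul_mem hb hd, ?_, ?_⟩
    · simp [hb0, hd0]
    · simp only [map_mul, map_add]; field_simp
  · rintro _ ⟨a, ha, b, hb, hb0, rfl⟩ ⟨c, hc, d, hd, hd0, h⟩
    have h0 : a * d + c * b ∈ Q.support := by
      rw [← hker, map_add, map_mul, map_mul]
      field_simp at h
      linear_combination -h
    have h1 : a * d ∈ Q.support := by
      refine ⟨mul_mem ha hd, ?_⟩
      change -(a * d) ∈ Q
      have : -(a * d) = c * b + -(a * d + c * b) := by ring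
      rw [this]
      exact add_mem (mul_mem hc hb) h0.2
    rw [← hker, map_mul, mul_eq_zero] at h1
    rw [h1.resolve_right hd0, zero_div]
  · rintro _ ⟨a, ha, b, hb, hb0, rfl⟩
    by_cases ha0 : ι a = 0
    · exact ⟨0, zero_mem Q, 1, one_mem Q, by simp, by simp [ha0]⟩
    · exact ⟨b, hb, a, ha, ha0, by rw [inv_div]⟩
  · rintro _ ⟨a, ha, b, hb, hb0, rfl⟩ _ ⟨c, hc, d, hd, hd0, rfl⟩
    rcases mem_or_neg_mem Q (a * d - c * b) with h | h
    · refine Or.inl ⟨_, h, b * d, mul_mem hb hd, by simp [hb0, hd0], ?_⟩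
      simp only [map_mul, map_sub]; field_simp
    · refine Or.inr ⟨_, h, b * d, mul_mem hb hd, by simp [hb0, hd0], ?_⟩
      simp only [map_mul, map_sub, map_neg]; field_simp; ring
  · exact fun a ha => ⟨a, ha, 1, one_mem Q, by simp, by simp⟩

namespace RingCone.IsFieldOrdering

variable {Ω : Type*} [Field Ω]

theorem exists_subfield {P : RingCone Ω} (hP : P.IsFieldOrdering) :
    ∃ (E : Subfield Ω) (_ : LinearOrder E) (_ : IsStrictOrderedRing E),
      (∀ x, x ∈ E ↔ x ∈ P ∨ -x ∈ P) ∧ ∀ x : E, 0 ≤ x ↔ (x : Ω) ∈ P := by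
  classical
  let E : Subfield Ω :=
    { carrier := {x | x ∈ P ∨ -x ∈ P}
      zero_mem' := Or.inl (zero_mem P)
      one_mem' := Or.inl (one_mem P)
      add_mem' := by
        rintro x y (hx | hx) (hy | hy)
        · exact Or.inl (add_mem hx hy)
        · exact (hP.sub_mem _ hx _ hy).imp (fun h => by rwa [sub_neg_eq_add] at h)
            (fun h => by rwa [neg_add, add_comm, ← sub_eq_add_neg])
        · exact (hP.sub_mem _ hy _ hx).imp (fun h => by rwa [sub_neg_eq_add, add_comm] at h)
            (fun h => by rwa [neg_add'])
        · refine Or.inr ?_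
          rw [neg_add]
          exact add_mem hx hy
      neg_mem' := by
        rintro x (hx | hx)
        · exact Or.inr (by rwa [neg_neg])
        · exact Or.inl hx
      mul_mem' := by
        rintro x y (hx | hx) (hy | hy)
        · exact Or.inl (mul_mem hx hy)
        · exact Or.inr (by simpa using mul_mem hx hy)
        · exact Or.inr (by simpa using mul_mem hx hy)
        · exact Or.inl (by simpa using mul_mem hx hy)
      inv_mem' := by
        rintro x (hx | hx)
        · exact Or.inl (hP.inv_mem _ hx)
        · exact Or.inr (by simpa using hP.inv_mem _ hx) }
  let C : RingCone E :=
    { P.toSubsemiring.comap E.subtype with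
      eq_zero_of_mem_of_neg_mem' := fun {a} ha hb =>
        Subtype.ext (P.eq_zero_of_mem_of_neg_mem' ha hb) }
  have : HasMemOrNegMem C := ⟨fun a => a.2⟩
  let _ : LinearOrder E := LinearOrder.mkOfAddGroupCone C
  have : IsOrderedRing E := IsOrderedRing.mkOfCone C
  refine ⟨E, inferInstance, inferInstance, fun x => Iff.rfl, fun x => ?_⟩
  change x - 0 ∈ C ↔ _
  rw [sub_zero]
  rfl

theorem exists_maximal {P : RingCone Ω} (hP : P.IsFieldOrdering) :
    ∃ Q : RingCone Ω, P ≤ Q ∧ Maximal RingCone.IsFieldOrdering Q := by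
  refine zorn_le_nonempty₀ {Q : RingCone Ω | Q.IsFieldOrdering} (fun c hcP hc y hy => ?_) P hP
  have key : ∀ {a b : Ω}, (∃ Q ∈ c, a ∈ Q) → (∃ Q ∈ c, b ∈ Q) → ∃ Q ∈ c, a ∈ Q ∧ b ∈ Q := by
    rintro a b ⟨Q, hQ, ha⟩ ⟨Q', hQ', hb⟩
    rcases hc.total hQ hQ' with h | h
    · exact ⟨Q', hQ', h ha, hb⟩
    · exact ⟨Q, hQ, ha, h hb⟩
  refine ⟨{ carrier := {x | ∃ Q ∈ c, x ∈ Q}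
            zero_mem' := ⟨y, hy, zero_mem y⟩
            one_mem' := ⟨y, hy, one_mem y⟩
            add_mem' := fun ha hb => ?_
            mul_mem' := fun ha hb => ?_
            eq_zero_of_mem_of_neg_mem' := fun ha hb => ?_ }, ⟨?_, ?_⟩,
            fun Q hQ x hx => ⟨Q, hQ, hx⟩⟩
  · obtain ⟨Q, hQ, h1, h2⟩ := key ha hb
    exact ⟨Q, hQ, mul_mem h1 h2⟩
  · obtain ⟨Q, hQ, h1, h2⟩ := key ha hb
    exact ⟨Q, hQ, add_mem h1 h2⟩
  · obtain ⟨Q, hQ, h1, h2⟩ := key ha hb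
    exact Q.eq_zero_of_mem_of_neg_mem' h1 h2
  · rintro x ⟨Q, hQ, hx⟩
    exact ⟨Q, hQ, (hcP hQ).inv_mem x hx⟩
  · rintro x hx y hy
    obtain ⟨Q, hQ, h1, h2⟩ := key hx hy
    exact ((hcP hQ).sub_mem x h1 y h2).imp (fun h => ⟨Q, hQ, h⟩) (fun h => ⟨Q, hQ, h⟩)

end RingCone.IsFieldOrdering

end Orderings

section RealClosure

open Polynomial hiding C X

/-- If a polynomial `p` changes sign and all sign changing polynomials of smaller degree have roots,
then the nonnegative constants and the ideal `(p)` lie in a proper preordering. -/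
theorem exists_preordering_of_sign_change {E : Type*} [Field E] [LinearOrder E]
    [IsStrictOrderedRing E] (p : E[X]) (a b : E) (hab : p.eval a * p.eval b < 0)
    (ih : ∀ r : E[X], r.natDegree < p.natDegree → r.eval a * r.eval b < 0 → ∃ c, r.eval c = 0) :
    ∃ T : RingPreordering E[X], p ∈ T ∧ -p ∈ T ∧ ∀ e : E, 0 ≤ e → Polynomial.C e ∈ T := by
  have hd : 0 < p.natDegree := by
    rw [Nat.pos_iff_ne_zero]
    intro h
    rw [eq_C_of_natDegree_eq_zero h, Polynomial.eval_C, Polynomial.eval_C] at hab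
    exact absurd hab (not_lt.2 (mul_self_nonneg _))
  have hp0 : p ≠ 0 := by rintro rfl; simp at hd
  let M : Submonoid E[X] :=
    { carrier := {q | ∃ e : E, 0 ≤ e ∧ ∃ u : E[X], q = Polynomial.C e * u ^ 2}
      one_mem' := ⟨1, zero_le_one, 1, by simp⟩
      mul_mem' := by
        rintro _ _ ⟨e, he, u, rfl⟩ ⟨e', he', u', rfl⟩
        exact ⟨e * e', mul_nonneg he he', u * u', by rw [Polynomial.C_mul]; ring⟩ }
  set S := M.subsemiringClosure with hS
  have hMS : ∀ q ∈ M, q ∈ S := fun q hq =>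
    (Submonoid.subsemiringClosure_mem M).2 (AddSubmonoid.subset_closure hq)
  have hred : ∀ s ∈ S, ∃ s', p ∣ s - s' ∧ s'.natDegree ≤ 2 * (p.natDegree - 1) ∧
      ∀ c, 0 ≤ s'.eval c := by
    intro s hs
    rw [hS, Submonoid.subsemiringClosure_mem] at hs
    induction hs using AddSubmonoid.closure_induction with
    | mem x hx =>
      obtain ⟨e, he, u, rfl⟩ := hx
      refine ⟨Polynomial.C e * (u % p) ^ 2, ?_, ?_, fun c => ?_⟩
      · have h1 : p ∣ u - u % p := ⟨u / p, by
          rw [sub_eq_iff_eq_add]; exact (EuclideanDomain.div_add_mod u p).symm⟩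
        have h2 : Polynomial.C e * u ^ 2 - Polynomial.C e * (u % p) ^ 2 =
            (u - u % p) * (Polynomial.C e * (u + u % p)) := by ring
        rw [h2]
        exact h1.mul_right _
      · refine (natDegree_C_mul_le _ _).trans (natDegree_pow_le.trans ?_)
        have := natDegree_mod_lt u hd.ne'
        omega
      · simp only [Polynomial.eval_mul, Polynomial.eval_C, Polynomial.eval_pow]
        positivity
    | zero => exact ⟨0, by simp, by simp, by simp⟩
    | add x y _ _ hx hy =>
      obtain ⟨x', h1, h2, h3⟩ := hx
      obtain ⟨y', h1', h2', h3'⟩ := hy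
      refine ⟨x' + y', ?_, (natDegree_add_le _ _).trans (max_le h2 h2'), fun c => ?_⟩
      · rw [add_sub_add_comm]
        exact dvd_add h1 h1'
      · rw [Polynomial.eval_add]
        exact add_nonneg (h3 c) (h3' c)
  refine ⟨RingPreordering.mk' {q | ∃ s ∈ S, p ∣ q - s} ?_ ?_ ?_ ?_, ⟨0, zero_mem S, by simp⟩,
    ⟨0, zero_mem S, by simp⟩, fun e he => ⟨Polynomial.C e, hMS _ ⟨e, he, 1, by simp⟩, by simp⟩⟩
  · rintro x y ⟨s, hs, h⟩ ⟨s', hs', h'⟩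
    refine ⟨s + s', add_mem hs hs', ?_⟩
    rw [add_sub_add_comm]
    exact dvd_add h h'
  · rintro x y ⟨s, hs, h⟩ ⟨s', hs', h'⟩
    refine ⟨s * s', mul_mem hs hs', ?_⟩
    have : x * y - s * s' = (x - s) * y + (y - s') * s := by ring
    rw [this]
    exact dvd_add (h.mul_right _) (h'.mul_right _)
  · exact fun x => ⟨x * x, hMS _ ⟨1, zero_le_one, x, by simp [sq]⟩, by simp⟩
  · rintro ⟨s, hs, h⟩
    obtain ⟨s', h1, h2, h3⟩ := hred s hs
    obtain ⟨r, hr⟩ : p ∣ 1 + s' := by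
      have : 1 + s' = -((-1 - s) + (s - s')) := by ring
      rw [this]
      exact (dvd_add h h1).neg_right
    have hpos : ∀ c, 0 < p.eval c * r.eval c := by
      intro c
      rw [← Polynomial.eval_mul, ← hr, Polynomial.eval_add, Polynomial.eval_one]
      linarith [h3 c]
    have hr0 : r ≠ 0 := by
      rintro rfl
      simpa using hpos 0
    have hdeg : p.natDegree + r.natDegree ≤ 2 * (p.natDegree - 1) := by
      rw [← natDegree_mul hp0 hr0, ← hr]
      refine (natDegree_add_le _ _).trans (max_le (by simp) h2)
    obtain ⟨c, hc⟩ := ih r (by omega) (by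
      by_contra hcon
      rw [not_lt] at hcon
      have h4 := mul_pos (hpos a) (hpos b)
      nlinarith [mul_nonneg (neg_nonneg.2 hab.le) hcon])
    have := hpos c
    rw [hc, mul_zero] at this
    exact this.false

/-- The intermediate value property only has to be checked for irreducible polynomials. -/
theorem polyIVT_of_irreducible {E : Type*} [Field E] [LinearOrder E] [IsStrictOrderedRing E]
    (h : ∀ p : E[X], Irreducible p → ∀ a b, p.eval a * p.eval b < 0 →
      (∀ r : E[X], r.natDegree < p.natDegree → r.eval a * r.eval b < 0 → ∃ c, r.eval c = 0) →
      ∃ c, p.eval c = 0) : PolyIVT E := by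
  have key : ∀ (n : ℕ) (p : E[X]), p.natDegree = n → ∀ a b, a < b → p.eval a * p.eval b < 0 →
      ∃ c, a < c ∧ c < b ∧ p.eval c = 0 := by
    intro n
    induction n using Nat.strong_induction_on with
    | _ n ih =>
    intro p hpn a b hab hp
    subst hpn
    have hd : p.natDegree ≠ 0 := by
      intro h
      rw [eq_C_of_natDegree_eq_zero h, Polynomial.eval_C, Polynomial.eval_C] at hp
      exact absurd hp (not_lt.2 (mul_self_nonneg _))
    have hp0 : p ≠ 0 := by rintro rfl; simp at hd
    by_cases hirr : Irreducible p
    · obtain ⟨α, hroot⟩ := h p hirr a b hp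
        (fun r hr hrab => (ih _ hr r rfl a b hab hrab).imp fun c hc => hc.2.2)
      obtain ⟨u, hu⟩ := dvd_iff_isRoot.2 hroot
      obtain ⟨k, hk⟩ : ∃ k, u = Polynomial.C k := by
        rcases hirr.isUnit_or_isUnit hu with h | h
        · exact absurd h (not_isUnit_X_sub_C _)
        · obtain ⟨k, -, hk⟩ := Polynomial.isUnit_iff.1 h
          exact ⟨k, hk.symm⟩
      refine ⟨α, ?_, ?_, hroot⟩
      all_goals
        rw [hu, hk] at hp
        simp only [Polynomial.eval_mul, Polynomial.eval_sub, Polynomial.eval_X,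
          Polynomial.eval_C] at hp
        by_contra! hcon
        have hprod : 0 ≤ (a - α) * (b - α) := by
          first
          | exact mul_nonneg (sub_nonneg.2 hcon) (sub_nonneg.2 (hcon.trans hab.le))
          | exact mul_nonneg_of_nonpos_of_nonpos (sub_nonpos.2 (hab.le.trans hcon))
              (sub_nonpos.2 hcon)
        nlinarith [mul_nonneg hprod (mul_self_nonneg k)]
    · obtain ⟨q, r, hq, hr, rfl⟩ : ∃ q r, ¬ IsUnit q ∧ ¬ IsUnit r ∧ p = q * r := by
        by_contra! hcon
        refine hirr ⟨fun h => hd (natDegree_eq_zero_of_isUnit h), fun q r h => ?_⟩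
        by_contra! hqr
        exact hcon q r hqr.1 hqr.2 h
      have hq0 : q ≠ 0 := left_ne_zero_of_mul hp0
      have hr0 : r ≠ 0 := right_ne_zero_of_mul hp0
      have hdeg := natDegree_mul hq0 hr0
      have hqd : 0 < q.natDegree := natDegree_pos_iff_degree_pos.2
        (degree_pos_of_ne_zero_of_nonunit hq0 hq)
      have hrd : 0 < r.natDegree := natDegree_pos_iff_degree_pos.2
        (degree_pos_of_ne_zero_of_nonunit hr0 hr)
      have hsplit : q.eval a * q.eval b < 0 ∨ r.eval a * r.eval b < 0 := by
        by_contra! hcon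
        simp only [Polynomial.eval_mul] at hp
        nlinarith [mul_nonneg hcon.1 hcon.2]
      rcases hsplit with h | h
      · obtain ⟨c, h1, h2, h3⟩ := ih _ (by omega) q rfl a b hab h
        exact ⟨c, h1, h2, by rw [Polynomial.eval_mul, h3, zero_mul]⟩
      · obtain ⟨c, h1, h2, h3⟩ := ih _ (by omega) r rfl a b hab h
        exact ⟨c, h1, h2, by rw [Polynomial.eval_mul, h3, mul_zero]⟩
  exact fun p a b hab ha hb => key _ p rfl a b hab (mul_neg_of_neg_of_pos ha hb)

theorem polyIVT_of_maximal {Ω : Type*} [Field Ω] [IsAlgClosed Ω] {P : RingCone Ω}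
    (hP : Maximal RingCone.IsFieldOrdering P)
    {E : Subfield Ω} [LinearOrder E] [IsStrictOrderedRing E] (hE : ∀ x, x ∈ E ↔ x ∈ P ∨ -x ∈ P)
    (hnonneg : ∀ x : E, 0 ≤ x ↔ (x : Ω) ∈ P) : PolyIVT E := by
  refine polyIVT_of_irreducible fun p hirr a b hp ih => ?_
  obtain ⟨α, hα⟩ := IsAlgClosed.exists_aeval_eq_zero Ω p (degree_pos_of_irreducible hirr).ne'
  obtain ⟨T, hpT, hnpT, hCT⟩ := exists_preordering_of_sign_change p a b hp ih
  obtain ⟨Q, hTQ, hQ⟩ := T.exists_le_isOrdering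
  have hmem : ∀ I : Ideal E[X], I ≠ ⊤ → p ∈ I → ∀ q, q ∈ I ↔ p ∣ q := by
    intro I hI hpI q
    refine ⟨fun hq => ?_, fun h => I.mem_of_dvd h hpI⟩
    by_contra hdvd
    obtain ⟨u, v, huv⟩ := (hirr.coprime_iff_not_dvd).2 hdvd
    exact hI ((I.eq_top_iff_one).2
      (huv ▸ I.add_mem (I.mul_mem_left _ hpI) (I.mul_mem_left _ hq)))
  set ι : E[X] →+* Ω := ((aeval α : E[X] →ₐ[E] Ω) : E[X] →+* Ω) with hι
  have hker : ∀ q, ι q = 0 ↔ q ∈ Q.support := fun q => by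
    rw [← RingHom.mem_ker, hmem _ (RingHom.ker_ne_top ι) hα,
      hmem _ (Q.support_ne_top) ⟨hTQ hpT, hTQ hnpT⟩]
  obtain ⟨P', hP', hQP'⟩ := Q.exists_ringCone ι hker
  have hPP' : P ≤ P' := by
    intro x hx
    have := hQP' _ (hTQ (hCT ⟨x, (hE x).2 (Or.inl hx)⟩ ((hnonneg _).2 hx)))
    have h2 : ι (Polynomial.C ⟨x, (hE x).2 (Or.inl hx)⟩) = x :=
      Polynomial.aeval_C α (⟨x, (hE x).2 (Or.inl hx)⟩ : E)
    rwa [h2] at this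
  have hPα : ∀ x ∈ P', x ∈ P := hP.le_of_ge hP' hPP'
  have hαE : α ∈ E := by
    rw [hE]
    refine (mem_or_neg_mem Q (Polynomial.X : E[X])).imp (fun h => hPα _ ?_) (fun h => hPα _ ?_)
    · simpa [ι] using hQP' _ h
    · simpa [ι] using hQP' _ h
  have hroot : ((p.eval ⟨α, hαE⟩ : E) : Ω) = 0 :=
    (Polynomial.aeval_algebraMap_apply Ω (⟨α, hαE⟩ : E) p).symm.trans hα
  exact ⟨⟨α, hαE⟩, Subtype.ext hroot⟩

end RealClosure

section Positivstellensatz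

universe u

/-- Every preordering becomes nonnegative under a homomorphism to some real closed field. -/
theorem RingPreordering.exists_ringHom {A : Type u} [CommRing A] (P : RingPreordering A) :
    ∃ (L : Type u) (_ : Field L) (_ : LinearOrder L) (_ : IsStrictOrderedRing L) (φ : A →+* L),
      PolyIVT L ∧ ∀ a ∈ P, 0 ≤ φ a := by
  obtain ⟨Q, hPQ, hQ⟩ := P.exists_le_isOrdering
  let Ω := AlgebraicClosure (FractionRing (A ⧸ Q.support))
  let ι : A →+* Ω := ((algebraMap (FractionRing (A ⧸ Q.support)) Ω).comp
    (algebraMap (A ⧸ Q.support) _)).comp (Ideal.Quotient.mk Q.support)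
  have hker : ∀ a, ι a = 0 ↔ a ∈ Q.support := by
    intro a
    simp only [ι, RingHom.comp_apply]
    rw [map_eq_zero, map_eq_zero_iff _ (IsFractionRing.injective (A ⧸ Q.support) _),
      Ideal.Quotient.eq_zero_iff_mem]
  obtain ⟨R₀, hR₀, hQR₀⟩ := Q.exists_ringCone ι hker
  obtain ⟨R, hle, hR⟩ := hR₀.exists_maximal
  obtain ⟨E, _, _, hE, hE'⟩ := hR.prop.exists_subfield
  have hιE : ∀ a, ι a ∈ E := fun a => (hE _).2 <| (mem_or_neg_mem Q a).imp
    (fun h => hle (hQR₀ _ h)) (fun h => by simpa using hle (hQR₀ _ h))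
  exact ⟨E, inferInstance, inferInstance, inferInstance, ι.codRestrict E hιE,
    polyIVT_of_maximal hR hE hE', fun a ha => (hE' _).2 (hle (hQR₀ _ (hPQ ha)))⟩

/-- A preordering of the real polynomial ring is nonnegative at a real point, as far as finitely
many of its members are concerned. -/
theorem RingPreordering.exists_eval_nonneg {n : ℕ} (P : RingPreordering (MvPolynomial (Fin n) ℝ))
    (S : Finset (MvPolynomial (Fin n) ℝ)) (hS : ∀ p ∈ S, p ∈ P) :
    ∃ y : Fin n → ℝ, ∀ p ∈ S, 0 ≤ eval y p := by
  obtain ⟨L, _, _, _, φ, hL, hφ⟩ := P.exists_ringHom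
  set i : ℝ →+* L := φ.comp C with hi
  have hmono : StrictMono i := by
    intro a b hab
    have h : i b - i a = i (√(b - a)) ^ 2 := by
      rw [← map_sub, ← map_pow, Real.sq_sqrt (sub_nonneg.2 hab.le)]
    have h0 : i (√(b - a)) ≠ 0 := by
      rw [map_ne_zero]
      exact (Real.sqrt_pos.2 (sub_pos.2 hab)).ne'
    have : 0 < i b - i a := by rw [h]; exact sq_pos_of_ne_zero h0
    linarith
  obtain ⟨y, hy⟩ := reflectsSigns_of_polyIVT n hL polyIVT_real i hmono S (fun k => φ (X k))
  refine ⟨y, fun p hp => ?_⟩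
  have h1 : eval₂ i (fun k => φ (X k)) p = φ p := by
    have := eval₂_comp_left φ C X p
    rw [eval₂_eta] at this
    exact this.symm
  have h2 := hy p hp
  rw [h1] at h2
  by_contra! hneg
  rw [sign_neg hneg, eq_comm, sign_eq_neg_one_iff] at h2
  exact h2.not_ge (hφ p (hS p hp))

end Positivstellensatz

section QuadraticModule

/-- Quadratic modules in a commutative ring. -/
structure AddSubmonoid.IsQuadraticModule {A : Type*} [CommRing A] (M : AddSubmonoid A) : Prop where
  one_mem : 1 ∈ M
  mul_self_mul_mem : ∀ a, ∀ m ∈ M, a * a * m ∈ M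

namespace AddSubmonoid.IsQuadraticModule

section CommRing

variable {A : Type*} [CommRing A] {M : AddSubmonoid A}

theorem sumSq_mul_mem (hM : M.IsQuadraticModule) {s m : A} (hs : IsSumSq s) (hm : m ∈ M) :
    s * m ∈ M := by
  induction hs with
  | zero => simp
  | sq_add a _ ih =>
    rw [add_mul]
    exact add_mem (hM.mul_self_mul_mem a m hm) ih

theorem sumSq_mem (hM : M.IsQuadraticModule) {s : A} (hs : IsSumSq s) : s ∈ M := by
  simpa using hM.sumSq_mul_mem hs hM.one_mem

theorem exists_adjoin (hM : M.IsQuadraticModule) (a : A) :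
    ∃ N : AddSubmonoid A, N.IsQuadraticModule ∧ M ≤ N ∧ a ∈ N ∧
      ∀ x ∈ N, ∃ m ∈ M, ∃ s, IsSumSq s ∧ x = m + s * a := by
  refine ⟨{ carrier := {x | ∃ m ∈ M, ∃ s, IsSumSq s ∧ x = m + s * a}
            zero_mem' := ⟨0, zero_mem M, 0, .zero, by simp⟩
            add_mem' := ?_ }, ⟨⟨1, hM.one_mem, 0, .zero, by simp⟩, ?_⟩,
            fun m hm => ⟨m, hm, 0, .zero, by simp⟩,
            ⟨0, zero_mem M, 1, by simp, by simp⟩, fun x hx => hx⟩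
  · rintro _ _ ⟨m, hm, s, hs, rfl⟩ ⟨m', hm', s', hs', rfl⟩
    exact ⟨m + m', add_mem hm hm', s + s', hs.add hs', by ring⟩
  · rintro x _ ⟨m, hm, s, hs, rfl⟩
    exact ⟨x * x * m, hM.mul_self_mul_mem x m hm, x * x * s,
      (IsSumSq.mul_self x).mul hs, by ring⟩

theorem exists_maximal (hM : M.IsQuadraticModule) (h1 : (-1 : A) ∉ M) :
    ∃ N, M ≤ N ∧ Maximal (fun N : AddSubmonoid A => N.IsQuadraticModule ∧ (-1 : A) ∉ N) N := by
  refine zorn_le_nonempty₀ {N : AddSubmonoid A | N.IsQuadraticModule ∧ (-1 : A) ∉ N}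
    (fun c hcP hc y hy => ?_) M ⟨hM, h1⟩
  have hmem : ∀ x, x ∈ sSup c ↔ ∃ N ∈ c, x ∈ N := fun x =>
    AddSubmonoid.mem_sSup_of_directedOn ⟨y, hy⟩ hc.directedOn
  refine ⟨sSup c, ⟨⟨?_, ?_⟩, ?_⟩, fun N hN => le_sSup hN⟩
  · exact (hmem _).2 ⟨y, hy, (hcP hy).1.one_mem⟩
  · intro a m hm
    obtain ⟨N, hN, h⟩ := (hmem _).1 hm
    exact (hmem _).2 ⟨N, hN, (hcP hN).1.mul_self_mul_mem a m h⟩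
  · intro h
    obtain ⟨N, hN, h⟩ := (hmem _).1 h
    exact (hcP hN).2 h

end CommRing

variable {A : Type*} [CommRing A] [Algebra ℝ A] {M : AddSubmonoid A}

theorem algebraMap_mul_mem (hM : M.IsQuadraticModule) {r : ℝ} (hr : 0 ≤ r) {m : A} (hm : m ∈ M) :
    algebraMap ℝ A r * m ∈ M := by
  have := hM.mul_self_mul_mem (algebraMap ℝ A (√r)) m hm
  rwa [← map_mul, Real.mul_self_sqrt hr] at this

theorem algebraMap_mem (hM : M.IsQuadraticModule) {r : ℝ} (hr : 0 ≤ r) : algebraMap ℝ A r ∈ M := by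
  simpa using hM.algebraMap_mul_mem hr hM.one_mem

theorem nonneg_of_algebraMap_mem (hM : M.IsQuadraticModule) (h1 : (-1 : A) ∉ M) {r : ℝ}
    (hr : algebraMap ℝ A r ∈ M) : 0 ≤ r := by
  by_contra! hneg
  refine h1 ?_
  have := hM.algebraMap_mul_mem (inv_nonneg.2 (neg_nonneg.2 hneg.le)) hr
  rw [← map_mul] at this
  convert this
  rw [inv_neg, neg_mul, inv_mul_cancel₀ hneg.ne, map_neg, map_one]

theorem mul_mem_of_mem_of_neg_mem (hM : M.IsQuadraticModule) {s : A} (hs : s ∈ M) (hs' : -s ∈ M)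
    (x : A) : s * x ∈ M := by
  set c : A := algebraMap ℝ A 2⁻¹ with hc
  have h2 : c + c = 1 := by rw [hc, ← map_add]; norm_num
  have : s * x = (c * (x + 1)) * (c * (x + 1)) * s + (c * (x - 1)) * (c * (x - 1)) * -s := by
    linear_combination -(s * x) * (c + c + 1) * h2
  rw [this]
  exact add_mem (hM.mul_self_mul_mem _ _ hs) (hM.mul_self_mul_mem _ _ hs')

theorem mem_or_neg_mem_of_maximal
    (hM : Maximal (fun N : AddSubmonoid A => N.IsQuadraticModule ∧ (-1 : A) ∉ N) M) (a : A) :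
    a ∈ M ∨ -a ∈ M := by
  have hq := hM.prop.1
  have key : ∀ a, a ∉ M → ∃ m ∈ M, ∃ s, IsSumSq s ∧ -1 = m + s * a := by
    intro a ha
    obtain ⟨N, hN, hle, haN, h⟩ := hq.exists_adjoin a
    by_cases h1 : (-1 : A) ∈ N
    · exact h _ h1
    · exact absurd (hM.le_of_ge ⟨hN, h1⟩ hle haN) ha
  by_contra! hcon
  obtain ⟨m, hm, s, hs, h⟩ := key a hcon.1
  obtain ⟨m', hm', s', hs', h'⟩ := key (-a) hcon.2
  have hneg : -s ∈ M := by
    have : -s = s' + (s' * m + s * m') := by linear_combination s' * h + s * h'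
    rw [this]
    exact add_mem (hq.sumSq_mem hs') (add_mem (hq.sumSq_mul_mem hs' hm) (hq.sumSq_mul_mem hs hm'))
  refine hM.prop.2 ?_
  rw [h]
  exact add_mem hm (hq.mul_mem_of_mem_of_neg_mem (hq.sumSq_mem hs) hneg a)

/-- If `N ± a` lie in a quadratic module, so does `N² - a²`. -/
theorem sq_sub_sq_mem (hM : M.IsQuadraticModule) {N : ℝ} (hN : 0 < N) {a : A}
    (h : algebraMap ℝ A N - a ∈ M) (h' : algebraMap ℝ A N + a ∈ M) :
    algebraMap ℝ A (N ^ 2) - a ^ 2 ∈ M := by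
  set b := algebraMap ℝ A N with hb
  set c := algebraMap ℝ A (2 * N)⁻¹ with hc
  have hbc : 2 * c * b = 1 := by
    rw [hb, hc, ← map_ofNat (algebraMap ℝ A) 2, ← map_mul, ← map_mul, ← map_one (algebraMap ℝ A)]
    congr 1
    field_simp
  have : algebraMap ℝ A (N ^ 2) - a ^ 2 =
      c * ((b - a) * (b - a) * (b + a) + (b + a) * (b + a) * (b - a)) := by
    rw [map_pow, ← hb]
    linear_combination (a ^ 2 - b ^ 2) * hbc
  rw [this]
  exact hM.algebraMap_mul_mem (by positivity)
    (add_mem (hM.mul_self_mul_mem _ _ h') (hM.mul_self_mul_mem _ _ h))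

/-- The elements bounded with respect to a quadratic module form a subalgebra. -/
theorem exists_bounded_subalgebra (hM : M.IsQuadraticModule) : ∃ B : Subalgebra ℝ A,
    ∀ a, a ∈ B ↔ ∃ N : ℝ, 0 < N ∧ algebraMap ℝ A N - a ∈ M ∧ algebraMap ℝ A N + a ∈ M := by
  let B₀ : Submodule ℝ A :=
    { carrier := {a | ∃ N : ℝ, 0 < N ∧ algebraMap ℝ A N - a ∈ M ∧ algebraMap ℝ A N + a ∈ M}
      zero_mem' := ⟨1, one_pos, by simpa using hM.one_mem, by simpa using hM.one_mem⟩
      add_mem' := by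
        rintro a b ⟨N, hN, h1, h2⟩ ⟨N', hN', h1', h2'⟩
        refine ⟨N + N', add_pos hN hN', ?_, ?_⟩
        · rw [map_add, add_sub_add_comm]
          exact add_mem h1 h1'
        · rw [map_add, add_add_add_comm]
          exact add_mem h2 h2'
      smul_mem' := by
        rintro r a ⟨N, hN, h1, h2⟩
        have key : ∀ c : ℝ, 0 ≤ c → ∀ x, algebraMap ℝ A N - x ∈ M →
            algebraMap ℝ A (c * N + 1) - c • x ∈ M := by
          intro c hc x hx
          have := add_mem (hM.algebraMap_mul_mem hc hx) hM.one_mem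
          convert this using 1
          rw [map_add, map_mul, map_one, Algebra.smul_def]
          ring
        refine ⟨|r| * N + 1, by positivity, ?_, ?_⟩
        · rcases le_total 0 r with hr | hr
          · rw [abs_of_nonneg hr]
            exact key r hr a h1
          · rw [abs_of_nonpos hr]
            simpa using key (-r) (neg_nonneg.2 hr) (-a) (by simpa using h2)
        · rcases le_total 0 r with hr | hr
          · rw [abs_of_nonneg hr]
            simpa using key r hr (-a) (by simpa using h2)
          · rw [abs_of_nonpos hr]
            simpa using key (-r) (neg_nonneg.2 hr) a h1 }
  have hone : (1 : A) ∈ B₀ := by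
    refine ⟨1, one_pos, by simp, ?_⟩
    rw [map_one]
    exact add_mem hM.one_mem hM.one_mem
  have hsq : ∀ a ∈ B₀, a ^ 2 ∈ B₀ := by
    rintro a ⟨N, hN, h1, h2⟩
    refine ⟨N ^ 2, by positivity, hM.sq_sub_sq_mem hN h1 h2,
      add_mem (hM.algebraMap_mem (by positivity)) ?_⟩
    simpa [sq] using hM.mul_self_mul_mem a 1 hM.one_mem
  have hmul : ∀ a ∈ B₀, ∀ b ∈ B₀, a * b ∈ B₀ := by
    intro a ha b hb
    have h := B₀.smul_mem (4⁻¹ : ℝ) (sub_mem (hsq _ (add_mem ha hb)) (hsq _ (sub_mem ha hb)))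
    convert h using 1
    have : (a + b) ^ 2 - (a - b) ^ 2 = (4 : ℝ) • (a * b) := by
      rw [Algebra.smul_def, map_ofNat]; ring
    rw [this, smul_smul, inv_mul_cancel₀ (by norm_num), one_smul]
  exact ⟨B₀.toSubalgebra hone fun a b ha hb => hmul a ha b hb, fun a => Iff.rfl⟩

/-- A proper Archimedean quadratic module is nonnegative under a character. -/
theorem exists_algHom_nonneg (hM : M.IsQuadraticModule) (h1 : (-1 : A) ∉ M)
    (hb : ∀ a, ∃ N : ℝ, algebraMap ℝ A N - a ∈ M) : ∃ φ : A →ₐ[ℝ] ℝ, ∀ m ∈ M, 0 ≤ φ m := by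
  obtain ⟨Q, hMQ, hQ⟩ := hM.exists_maximal h1
  have hq := hQ.prop.1
  let I : Submodule ℝ A :=
    { carrier := {a | ∀ ε : ℝ, 0 < ε → algebraMap ℝ A ε - a ∈ Q ∧ algebraMap ℝ A ε + a ∈ Q}
      zero_mem' := fun ε hε => by simpa using hq.algebraMap_mem hε.le
      add_mem' := by
        intro a b ha hb ε hε
        obtain ⟨h1, h2⟩ := ha _ (half_pos hε)
        obtain ⟨h3, h4⟩ := hb _ (half_pos hε)
        have h5 := add_mem h1 h3
        have h6 := add_mem h2 h4
        rw [sub_add_sub_comm, ← map_add, add_halves] at h5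
        rw [add_add_add_comm, ← map_add, add_halves] at h6
        exact ⟨h5, h6⟩
      smul_mem' := by
        intro r a ha ε hε
        have key : ∀ c : ℝ, 0 < c → ∀ x, algebraMap ℝ A (ε / c) - x ∈ Q →
            algebraMap ℝ A ε - c • x ∈ Q := by
          intro c hc x hx
          have := hq.algebraMap_mul_mem hc.le hx
          rwa [mul_sub, ← map_mul, mul_div_cancel₀ _ hc.ne', ← Algebra.smul_def] at this
        rcases lt_trichotomy r 0 with hr | rfl | hr
        · have hr' := neg_pos.2 hr
          obtain ⟨h1, h2⟩ := ha _ (div_pos hε hr')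
          exact ⟨by simpa using key (-r) hr' (-a) (by simpa using h2),
            by simpa using key (-r) hr' a h1⟩
        · simpa using hq.algebraMap_mem hε.le
        · obtain ⟨h1, h2⟩ := ha _ (div_pos hε hr)
          exact ⟨key r hr a h1, by simpa using key r hr (-a) (by simpa using h2)⟩ }
  have hsq : ∀ a ∈ I, a ^ 2 ∈ I := by
    intro a ha ε hε
    obtain ⟨h1, h2⟩ := ha _ (Real.sqrt_pos.2 hε)
    have := hq.sq_sub_sq_mem (Real.sqrt_pos.2 hε) h1 h2
    rw [Real.sq_sqrt hε.le] at this
    refine ⟨this, add_mem (hq.algebraMap_mem hε.le) ?_⟩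
    simpa [sq] using hq.mul_self_mul_mem a 1 hq.one_mem
  have hreal : ∀ r : ℝ, algebraMap ℝ A r ∈ I → r = 0 := by
    intro r hr
    have h : ∀ ε, 0 < ε → r ≤ ε ∧ -r ≤ ε := by
      intro ε hε
      obtain ⟨h1, h2⟩ := hr ε hε
      rw [← map_sub] at h1
      rw [← map_add] at h2
      exact ⟨by linarith [hq.nonneg_of_algebraMap_mem hQ.prop.2 h1],
        by linarith [hq.nonneg_of_algebraMap_mem hQ.prop.2 h2]⟩
    have h1 := le_of_forall_pos_le_add fun ε hε => (h ε hε).1.trans (zero_add ε).ge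
    have h2 := le_of_forall_pos_le_add fun ε hε => (h ε hε).2.trans (zero_add ε).ge
    linarith
  have hex : ∀ a, ∃ r : ℝ, a - algebraMap ℝ A r ∈ I := by
    intro a
    set S : Set ℝ := {r | a - algebraMap ℝ A r ∈ Q}
    have hne : S.Nonempty := by
      obtain ⟨N, hN⟩ := hb (-a)
      refine ⟨-N, ?_⟩
      change a - algebraMap ℝ A (-N) ∈ Q
      rw [map_neg, sub_neg_eq_add, add_comm]
      simpa using hMQ hN
    have hbdd : BddAbove S := by
      obtain ⟨N, hN⟩ := hb a
      refine ⟨N, fun r hr => ?_⟩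
      have := add_mem (hMQ hN) hr
      rw [sub_add_sub_cancel, ← map_sub] at this
      linarith [hq.nonneg_of_algebraMap_mem hQ.prop.2 this]
    refine ⟨sSup S, fun ε hε => ⟨?_, ?_⟩⟩
    · have hnot : sSup S + ε ∉ S := fun h => by linarith [le_csSup hbdd h]
      have := (mem_or_neg_mem_of_maximal hQ _).resolve_left hnot
      rw [map_add] at this
      convert this using 1
      ring
    · obtain ⟨r, hr, hlt⟩ := exists_lt_of_lt_csSup hne (sub_lt_self (sSup S) hε)
      have := add_mem hr (hq.algebraMap_mem (r := r - sSup S + ε) (by linarith))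
      convert this using 1
      rw [map_add, map_sub]
      ring
  choose φ hφ using hex
  have huniq : ∀ a r, a - algebraMap ℝ A r ∈ I → φ a = r := by
    intro a r h
    have := sub_mem h (hφ a)
    rw [sub_sub_sub_cancel_left, ← map_sub] at this
    linarith [hreal _ this]
  have hadd : ∀ a b, φ (a + b) = φ a + φ b := fun a b => huniq _ _ (by
    rw [map_add, add_sub_add_comm]
    exact add_mem (hφ a) (hφ b))
  have hsmul : ∀ (r : ℝ) a, φ (algebraMap ℝ A r * a) = r * φ a := fun r a => huniq _ _ (by
    rw [map_mul, ← mul_sub, ← Algebra.smul_def]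
    exact I.smul_mem r (hφ a))
  have hφsq : ∀ a, φ (a ^ 2) = φ a ^ 2 := fun a => huniq _ _ (by
    have : a ^ 2 - algebraMap ℝ A (φ a ^ 2) =
        (a - algebraMap ℝ A (φ a)) ^ 2 + (2 * φ a) • (a - algebraMap ℝ A (φ a)) := by
      rw [Algebra.smul_def, map_mul, map_pow, map_ofNat]
      ring
    rw [this]
    exact add_mem (hsq _ (hφ a)) (I.smul_mem _ (hφ a)))
  have hmul : ∀ a b, φ (a * b) = φ a * φ b := by
    intro a b
    have h := hφsq (a + b)
    have h2 : (a + b) ^ 2 = a ^ 2 + algebraMap ℝ A 2 * (a * b) + b ^ 2 := by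
      rw [map_ofNat]; ring
    rw [h2, hadd, hadd, hsmul, hφsq, hφsq, hadd] at h
    linarith
  have halg : ∀ r : ℝ, φ (algebraMap ℝ A r) = r := fun r => huniq _ _ (by simp)
  refine ⟨{ toFun := φ
            map_one' := by simpa using halg 1
            map_zero' := by simpa using halg 0
            map_add' := hadd
            map_mul' := hmul
            commutes' := halg }, fun m hm => ?_⟩
  change 0 ≤ φ m
  by_contra! hneg
  have h := (hφ m (-φ m / 2) (by linarith)).1
  have h' := add_mem h (hMQ hm)
  have : algebraMap ℝ A (-φ m / 2) - (m - algebraMap ℝ A (φ m)) + m = algebraMap ℝ A (φ m / 2) := by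
    have : φ m / 2 = -φ m / 2 + φ m := by ring
    rw [this, map_add]
    ring
  rw [this] at h'
  linarith [hq.nonneg_of_algebraMap_mem hQ.prop.2 h']

end AddSubmonoid.IsQuadraticModule

end QuadraticModule

section Cones

variable {σ ι : Type*}

theorem isSOS_iff_isSumSq {p : MvPolynomial σ ℝ} : IsSOS p ↔ IsSumSq p := by
  refine ⟨?_, fun h => ?_⟩
  · rintro ⟨k, q, rfl⟩
    exact IsSumSq.sum_sq _ _
  · induction h with
    | zero => exact ⟨0, 0, by simp⟩
    | sq_add a _ ih =>
      obtain ⟨k, q, rfl⟩ := ih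
      exact ⟨k + 1, Fin.cons a q, by simp [Fin.sum_univ_succ, sq]⟩

variable [Fintype ι]

section InQM

theorem inQM_iff {g : ι → MvPolynomial σ ℝ} {p : MvPolynomial σ ℝ} :
    InQM g p ↔ ∃ (s₀ : MvPolynomial σ ℝ) (s : ι → MvPolynomial σ ℝ),
      IsSumSq s₀ ∧ (∀ j, IsSumSq (s j)) ∧ p = s₀ + ∑ j, s j * g j := by
  simp only [InQM, isSOS_iff_isSumSq]

/-- The quadratic module generated by `g`. -/
def quadraticModule (g : ι → MvPolynomial σ ℝ) : AddSubmonoid (MvPolynomial σ ℝ) where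
  carrier := {p | InQM g p}
  zero_mem' := inQM_iff.2 ⟨0, 0, .zero, fun _ => .zero, by simp⟩
  add_mem' := by
    intro p q hp hq
    obtain ⟨s₀, s, h₀, h, rfl⟩ := inQM_iff.1 hp
    obtain ⟨s₀', s', h₀', h', rfl⟩ := inQM_iff.1 hq
    refine inQM_iff.2 ⟨s₀ + s₀', s + s', h₀.add h₀', fun j => (h j).add (h' j), ?_⟩
    simp only [Pi.add_apply, add_mul, Finset.sum_add_distrib]
    ring

theorem isQuadraticModule_quadraticModule (g : ι → MvPolynomial σ ℝ) :
    (quadraticModule g).IsQuadraticModule where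
  one_mem := inQM_iff.2 ⟨1, 0, by simp, fun _ => .zero, by simp⟩
  mul_self_mul_mem := by
    intro a p hp
    obtain ⟨s₀, s, h₀, h, rfl⟩ := inQM_iff.1 hp
    refine inQM_iff.2 ⟨a * a * s₀, fun j => a * a * s j, (IsSumSq.mul_self a).mul h₀,
      fun j => (IsSumSq.mul_self a).mul (h j), ?_⟩
    rw [mul_add, Finset.mul_sum]
    simp only [mul_assoc]

theorem mem_quadraticModule (g : ι → MvPolynomial σ ℝ) (j : ι) : g j ∈ quadraticModule g := by
  classical
  refine inQM_iff.2 ⟨0, Pi.single j 1, .zero, fun k => ?_, ?_⟩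
  · by_cases h : k = j
    · subst h; simp
    · simp [h]
  · simp [Pi.single_apply]

end InQM

variable [DecidableEq ι]

theorem inPre_iff {g : ι → MvPolynomial σ ℝ} {p : MvPolynomial σ ℝ} :
    InPre g p ↔ ∃ s : Finset ι → MvPolynomial σ ℝ, (∀ A, IsSumSq (s A)) ∧
      p = ∑ A : Finset ι, s A * ∏ j ∈ A, g j := by
  simp only [InPre, isSOS_iff_isSumSq]

/-- The preordering generated by `g`, as an additive monoid. -/
def preordering (g : ι → MvPolynomial σ ℝ) : AddSubmonoid (MvPolynomial σ ℝ) where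
  carrier := {p | InPre g p}
  zero_mem' := inPre_iff.2 ⟨0, fun _ => .zero, by simp⟩
  add_mem' := by
    intro p q hp hq
    obtain ⟨s, h, rfl⟩ := inPre_iff.1 hp
    obtain ⟨s', h', rfl⟩ := inPre_iff.1 hq
    refine inPre_iff.2 ⟨s + s', fun A => (h A).add (h' A), ?_⟩
    simp only [Pi.add_apply, add_mul, Finset.sum_add_distrib]

theorem mul_prod_mem_preordering (g : ι → MvPolynomial σ ℝ) {s : MvPolynomial σ ℝ}
    (hs : IsSumSq s) (A : Finset ι) : s * ∏ j ∈ A, g j ∈ preordering g := by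
  refine inPre_iff.2 ⟨Pi.single A s, fun B => ?_, ?_⟩
  · by_cases h : B = A
    · subst h; simpa using hs
    · simp [h]
  · simp [Pi.single_apply]

theorem mul_mem_preordering (g : ι → MvPolynomial σ ℝ) {p q : MvPolynomial σ ℝ}
    (hp : p ∈ preordering g) (hq : q ∈ preordering g) : p * q ∈ preordering g := by
  obtain ⟨s, hs, rfl⟩ := inPre_iff.1 hp
  obtain ⟨t, ht, rfl⟩ := inPre_iff.1 hq
  rw [Finset.sum_mul_sum]
  refine sum_mem fun A _ => sum_mem fun B _ => ?_
  have hAB : (∏ j ∈ A, g j) * ∏ j ∈ B, g j = (∏ j ∈ A ∩ B, g j) * (∏ j ∈ A ∩ B, g j) *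
      ∏ j ∈ (A ∪ B) \ (A ∩ B), g j := by
    rw [← Finset.prod_union_inter,
      ← Finset.prod_sdiff (Finset.inter_subset_union (s := A) (t := B))]
    ring
  have : s A * (∏ j ∈ A, g j) * (t B * ∏ j ∈ B, g j) = s A * t B *
      ((∏ j ∈ A ∩ B, g j) * (∏ j ∈ A ∩ B, g j)) * ∏ j ∈ (A ∪ B) \ (A ∩ B), g j := by
    linear_combination s A * t B * hAB
  rw [this]
  exact mul_prod_mem_preordering g (((hs A).mul (ht B)).mul (IsSumSq.mul_self _)) _

theorem mul_self_mem_preordering (g : ι → MvPolynomial σ ℝ) (a : MvPolynomial σ ℝ) :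
    a * a ∈ preordering g := by
  simpa using mul_prod_mem_preordering g (IsSumSq.mul_self a) ∅

theorem isQuadraticModule_preordering (g : ι → MvPolynomial σ ℝ) :
    (preordering g).IsQuadraticModule where
  one_mem := by simpa using mul_self_mem_preordering g 1
  mul_self_mul_mem a _ hp := mul_mem_preordering g (mul_self_mem_preordering g a) hp

theorem mem_preordering (g : ι → MvPolynomial σ ℝ) (j : ι) : g j ∈ preordering g := by
  simpa using mul_prod_mem_preordering g IsSumSq.one {j}

end Cones

section Certificates

variable {n m l : ℕ} (g : Fin m → MvPolynomial (Fin n) ℝ) (h : Fin l → MvPolynomial (Fin n) ℝ)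

theorem eval_eq_zero_of_mem_span {p : MvPolynomial (Fin n) ℝ}
    (hp : p ∈ Ideal.span (Set.range h)) {x : Fin n → ℝ} (hx : ∀ t, eval x (h t) = 0) :
    eval x p = 0 := by
  have : Ideal.span (Set.range h) ≤ RingHom.ker (eval x) :=
    Ideal.span_le.2 (by rintro _ ⟨t, rfl⟩; exact hx t)
  exact this hp

/-- The Positivstellensatz: if `g ≥ 0` has no solution on the real zero set of `h`, then `-1`
lies in the preordering generated by `g` modulo `h`. -/
theorem exists_mem_preordering_eq_neg_one
    (hempty : ∀ x : Fin n → ℝ, (∀ t, eval x (h t) = 0) → ∃ j, eval x (g j) < 0) :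
    ∃ p ∈ preordering g, ∀ x : Fin n → ℝ, (∀ t, eval x (h t) = 0) → eval x p = -1 := by
  classical
  set I := Ideal.span (Set.range h) with hI
  by_cases h1 : ∃ p ∈ preordering g, -1 - p ∈ I
  · obtain ⟨p, hp, hpI⟩ := h1
    refine ⟨p, hp, fun x hx => ?_⟩
    have := eval_eq_zero_of_mem_span h hpI hx
    simp only [map_sub, map_neg, map_one] at this
    linarith
  exfalso
  let P : RingPreordering (MvPolynomial (Fin n) ℝ) :=
    RingPreordering.mk' {q | ∃ p ∈ preordering g, q - p ∈ I}
      (by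
        rintro x y ⟨p, hp, h⟩ ⟨p', hp', h'⟩
        refine ⟨p + p', add_mem hp hp', ?_⟩
        rw [add_sub_add_comm]
        exact add_mem h h')
      (by
        rintro x y ⟨p, hp, h⟩ ⟨p', hp', h'⟩
        refine ⟨p * p', mul_mem_preordering g hp hp', ?_⟩
        have : x * y - p * p' = y * (x - p) + p * (y - p') := by ring
        rw [this]
        exact add_mem (I.mul_mem_left _ h) (I.mul_mem_left _ h'))
      (fun x => ⟨x * x, mul_self_mem_preordering g x, by simp⟩) h1
  have hIP : ∀ q ∈ I, q ∈ P := fun q hq => ⟨0, zero_mem _, by simpa using hq⟩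
  have hhI : ∀ t, h t ∈ I := fun t => Ideal.subset_span ⟨t, rfl⟩
  obtain ⟨y, hy⟩ := P.exists_eval_nonneg
    (Finset.univ.image g ∪ (Finset.univ.image h ∪ Finset.univ.image (-h))) (by
      intro p hp
      simp only [Finset.mem_union, Finset.mem_image, Finset.mem_univ, true_and] at hp
      rcases hp with ⟨j, rfl⟩ | ⟨t, rfl⟩ | ⟨t, rfl⟩
      · exact ⟨g j, mem_preordering g j, by simp⟩
      · exact hIP _ (hhI t)
      · exact hIP _ (neg_mem (hhI t)))
  obtain ⟨j, hj⟩ := hempty y fun t => le_antisymm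
    (by simpa using hy (-h t) (by simp)) (hy (h t) (by simp))
  exact hj.not_ge (hy (g j) (by simp))

/-- The Archimedean Positivstellensatz, with the quadratic module in place of the preordering. -/
theorem exists_mem_quadraticModule_eq_neg_one (hg : ArchCond g)
    (hempty : ∀ x : Fin n → ℝ, (∀ t, eval x (h t) = 0) → ∃ j, eval x (g j) < 0) :
    ∃ p ∈ quadraticModule g, ∀ x : Fin n → ℝ, (∀ t, eval x (h t) = 0) → eval x p = -1 := by
  set I := Ideal.span (Set.range h) with hI
  by_cases h1 : ∃ p ∈ quadraticModule g, -1 - p ∈ I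
  · obtain ⟨p, hp, hpI⟩ := h1
    refine ⟨p, hp, fun x hx => ?_⟩
    have := eval_eq_zero_of_mem_span h hpI hx
    simp only [map_sub, map_neg, map_one] at this
    linarith
  exfalso
  have hQ := isQuadraticModule_quadraticModule g
  let M : AddSubmonoid (MvPolynomial (Fin n) ℝ) :=
    { carrier := {q | ∃ p ∈ quadraticModule g, q - p ∈ I}
      zero_mem' := ⟨0, zero_mem _, by simp⟩
      add_mem' := by
        rintro x y ⟨p, hp, h⟩ ⟨p', hp', h'⟩
        refine ⟨p + p', add_mem hp hp', ?_⟩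
        rw [add_sub_add_comm]
        exact add_mem h h' }
  have hle : ∀ q ∈ quadraticModule g, q ∈ M := fun q hq => ⟨q, hq, by simp⟩
  have hM : M.IsQuadraticModule := ⟨hle _ hQ.one_mem, by
    rintro a q ⟨p, hp, h⟩
    refine ⟨a * a * p, hQ.mul_self_mul_mem a p hp, ?_⟩
    rw [← mul_sub]
    exact I.mul_mem_left _ h⟩
  obtain ⟨B, hB⟩ := hM.exists_bounded_subalgebra
  obtain ⟨R, hR, hRg⟩ := hg
  have hX : ∀ i : Fin n, X i ∈ B := by
    intro i
    have h2 : C R - X i ^ 2 ∈ M := by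
      have hsum : (∑ k ∈ Finset.univ.erase i, X k ^ 2 : MvPolynomial (Fin n) ℝ) ∈ M :=
        sum_mem fun k _ => hM.sumSq_mem (sq (X k : MvPolynomial (Fin n) ℝ) ▸ IsSumSq.mul_self _)
      have := add_mem (hle _ hRg) hsum
      rw [← Finset.add_sum_erase _ _ (Finset.mem_univ i)] at this
      convert this using 1
      ring
    have hhalf : (C 2⁻¹ : MvPolynomial (Fin n) ℝ) * 2 = 1 := by
      rw [← map_ofNat C 2, ← C_mul]; norm_num
    have key : ∀ u : MvPolynomial (Fin n) ℝ, u * u = X i ^ 2 →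
        algebraMap ℝ _ ((R + 1) / 2) - u ∈ M := by
      intro u hu
      have h3 := hM.algebraMap_mul_mem (r := 2⁻¹) (by norm_num)
        (add_mem h2 (hM.sumSq_mem (IsSumSq.mul_self (u - 1))))
      convert h3 using 1
      rw [algebraMap_eq, div_eq_mul_inv, C_mul, C_add, C_1]
      linear_combination u * hhalf - C 2⁻¹ * hu
    refine (hB _).2 ⟨(R + 1) / 2, by positivity, key _ (sq _).symm, ?_⟩
    simpa using key (-X i) (by ring)
  have htop : ∀ p, p ∈ B := fun p => by
    have : B = ⊤ := top_le_iff.1 (adjoin_range_X (R := ℝ) (σ := Fin n) ▸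
      Algebra.adjoin_le (by rintro _ ⟨i, rfl⟩; exact hX i))
    rw [this]
    trivial
  obtain ⟨φ, hφ⟩ := hM.exists_algHom_nonneg h1 fun a => by
    obtain ⟨N, -, hN, -⟩ := (hB a).1 (htop a)
    exact ⟨N, hN⟩
  have hev : ∀ p, φ p = eval (fun i => φ (X i)) p := fun p => by
    conv_lhs => rw [aeval_unique φ]
    rfl
  have hIM : ∀ q ∈ I, q ∈ M := fun q hq => ⟨0, zero_mem _, by simpa using hq⟩
  have hhI : ∀ t, h t ∈ I := fun t => Ideal.subset_span ⟨t, rfl⟩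
  obtain ⟨j, hj⟩ := hempty (fun i => φ (X i)) fun t => by
    rw [← hev]
    refine le_antisymm ?_ (hφ _ (hIM _ (hhI t)))
    simpa using hφ _ (hIM _ (neg_mem (hhI t)))
  rw [← hev] at hj
  exact hj.not_ge (hφ _ (hle _ (mem_quadraticModule g j)))

end Certificates

section Varieties

variable {n : ℕ}

theorem evalC_eq_aeval (p : MvPolynomial (Fin n) ℝ) (z : Fin n → ℂ) : evalC p z = aeval z p := by
  rw [evalC, eval_map, aeval_def]

theorem evalC_ofReal (p : MvPolynomial (Fin n) ℝ) (x : Fin n → ℝ) :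
    evalC p (fun i => (x i : ℂ)) = (eval x p : ℝ) := by
  rw [evalC_eq_aeval]
  exact aeval_algebraMap_apply ℂ x p

theorem IsRealVariety.exists_separating {V W : Set (Fin n → ℂ)} (hV : IsRealVariety V)
    (hW : IsRealVariety W) (hVW : Disjoint V W) : ∃ e : MvPolynomial (Fin n) ℝ,
      (∀ z ∈ V, evalC e z = 1) ∧ ∀ z ∈ W, evalC e z = 0 := by
  obtain ⟨k, h, rfl⟩ := hV
  obtain ⟨l, h', rfl⟩ := hW
  have hzero : ∀ {k : ℕ} (h : Fin k → MvPolynomial (Fin n) ℝ),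
      {z | ∀ t, evalC (h t) z = 0} = zeroLocus ℂ (Ideal.span (Set.range h)) := by
    intro k h
    rw [zeroLocus_span]
    ext z
    change (∀ t, evalC (h t) z = 0) ↔ ∀ p ∈ Set.range h, aeval z p = 0
    simp [evalC_eq_aeval]
  rw [hzero, hzero] at hVW
  rw [hzero, hzero]
  set I := Ideal.span (Set.range h)
  set J := Ideal.span (Set.range h')
  have htop : I ⊔ J = ⊤ := by
    rw [← Ideal.radical_eq_top, ← vanishingIdeal_zeroLocus_eq_radical (K := ℂ)]
    have : zeroLocus ℂ (I ⊔ J) = ∅ := Set.eq_empty_of_forall_notMem fun z hz =>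
      Set.disjoint_left.1 hVW (zeroLocus_anti_mono le_sup_left hz)
        (zeroLocus_anti_mono le_sup_right hz)
    rw [this, vanishingIdeal_empty]
  obtain ⟨a, ha, b, hb, hab⟩ := Submodule.mem_sup.1 ((Ideal.eq_top_iff_one _).1 htop)
  refine ⟨b, fun z hz => ?_, fun z hz => ?_⟩
  · have := congrArg (aeval z) hab
    rw [map_add, hz a ha, zero_add, map_one] at this
    rw [evalC_eq_aeval, this]
  · rw [evalC_eq_aeval, hz b hb]

theorem exists_mem_eq_on_iUnion {m r : ℕ} {f : MvPolynomial (Fin n) ℝ}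
    {g : Fin m → MvPolynomial (Fin n) ℝ} {U : Fin r → Set (Fin n → ℂ)}
    (hf : ∀ x ∈ Sg g, 0 ≤ eval x f) (hU : ∀ j, IsRealVariety (U j))
    (hdisj : ∀ i j, i ≠ j → Disjoint (U i) (U j))
    (hconst : ∀ j, ∃ c : ℂ, ∀ z ∈ U j, evalC f z = c)
    {M : AddSubmonoid (MvPolynomial (Fin n) ℝ)} (hM : M.IsQuadraticModule)
    (hcert : ∀ (l : ℕ) (h : Fin l → MvPolynomial (Fin n) ℝ),
      (∀ x : Fin n → ℝ, (∀ t, eval x (h t) = 0) → ∃ j, eval x (g j) < 0) →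
      ∃ p ∈ M, ∀ x : Fin n → ℝ, (∀ t, eval x (h t) = 0) → eval x p = -1) :
    ∃ q ∈ M, ∀ x : Fin n → ℝ, (fun i => (x i : ℂ)) ∈ ⋃ j, U j → eval x (f - q) = 0 := by
  have hsep : ∀ j, ∃ e : MvPolynomial (Fin n) ℝ,
      (∀ x : Fin n → ℝ, (fun i => (x i : ℂ)) ∈ U j → eval x e = 1) ∧
      ∀ k ≠ j, ∀ x : Fin n → ℝ, (fun i => (x i : ℂ)) ∈ U k → eval x e = 0 := by
    intro j
    have : ∀ k, ∃ e : MvPolynomial (Fin n) ℝ,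
        (∀ x : Fin n → ℝ, (fun i => (x i : ℂ)) ∈ U j → eval x e = 1) ∧
        (k ≠ j → ∀ x : Fin n → ℝ, (fun i => (x i : ℂ)) ∈ U k → eval x e = 0) := by
      intro k
      by_cases hkj : k = j
      · exact ⟨1, by simp, fun h => absurd hkj h⟩
      · obtain ⟨e, h1, h0⟩ := (hU j).exists_separating (hU k) (hdisj j k (Ne.symm hkj))
        refine ⟨e, fun x hx => ?_, fun _ x hx => ?_⟩
        · have := h1 _ hx
          rw [evalC_ofReal] at this
          exact_mod_cast this
        · have := h0 _ hx
          rw [evalC_ofReal] at this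
          exact_mod_cast this
    choose e h1 h0 using this
    refine ⟨∏ k, e k, fun x hx => ?_, fun k hk x hx => ?_⟩
    · rw [map_prod]
      exact Finset.prod_eq_one fun k _ => h1 k x hx
    · rw [map_prod]
      exact Finset.prod_eq_zero (Finset.mem_univ k) (h0 k hk x hx)
  have hval : ∀ j, ∃ p ∈ M, ∀ x : Fin n → ℝ, (fun i => (x i : ℂ)) ∈ U j →
      eval x p = eval x f := by
    intro j
    by_cases hne : ∃ x : Fin n → ℝ, (fun i => (x i : ℂ)) ∈ U j
    swap
    · exact ⟨0, zero_mem M, fun x hx => absurd ⟨x, hx⟩ hne⟩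
    obtain ⟨x₀, hx₀⟩ := hne
    have hfc : ∀ x : Fin n → ℝ, (fun i => (x i : ℂ)) ∈ U j → eval x f = eval x₀ f := by
      intro x hx
      obtain ⟨c, hc⟩ := hconst j
      have := (hc _ hx).trans (hc _ hx₀).symm
      rw [evalC_ofReal, evalC_ofReal] at this
      exact_mod_cast this
    rcases le_or_gt 0 (eval x₀ f) with h0 | h0
    · refine ⟨C (eval x₀ f), hM.algebraMap_mem h0, fun x hx => ?_⟩
      rw [eval_C, hfc x hx]
    · obtain ⟨l, h, hUh⟩ := hU j
      have hmem : ∀ x : Fin n → ℝ, (fun i => (x i : ℂ)) ∈ U j ↔ ∀ t, eval x (h t) = 0 := by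
        intro x
        rw [hUh]
        change (∀ t, evalC (h t) _ = 0) ↔ _
        simp [evalC_ofReal]
      obtain ⟨p, hp, hp1⟩ := hcert l h fun x hx => by
        by_contra! hcon
        have := hf x hcon
        rw [hfc x ((hmem x).2 hx)] at this
        linarith
      refine ⟨C (-eval x₀ f) * p, hM.algebraMap_mul_mem (by linarith) hp, fun x hx => ?_⟩
      rw [map_mul, eval_C, hp1 x ((hmem x).1 hx), hfc x hx]
      ring
  choose e h1 h0 using hsep
  choose p hp hpf using hval
  refine ⟨∑ j, e j * e j * p j, sum_mem fun j _ => hM.mul_self_mul_mem _ _ (hp j),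
    fun x hx => ?_⟩
  obtain ⟨j, hj⟩ := Set.mem_iUnion.1 hx
  rw [map_sub, map_sum, Finset.sum_eq_single j, map_mul, map_mul, h1 j x hj, hpf j x hj]
  · ring
  · intro k _ hk
    rw [map_mul, map_mul, h0 k j hk.symm x hj]
    ring
  · simp

end Varieties

/-- If `f` is non-negative on `S(g)` and `U = U₁ ∪ … ∪ U_r` is a union of pairwise disjoint
complex varieties defined by real polynomials on each of which `f` is constant, then there is
`q ∈ P(g)` with `f − q` vanishing on `U ∩ ℝⁿ`; moreover, under the Archimedean condition one
can take `q ∈ Q(g)`. -/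
theorem rep_on_union_of_varieties {n m r : ℕ} (f : MvPolynomial (Fin n) ℝ)
    (g : Fin m → MvPolynomial (Fin n) ℝ)
    (U : Fin r → Set (Fin n → ℂ))
    (hf : ∀ x ∈ Sg g, 0 ≤ eval x f)
    (hU : ∀ j, IsRealVariety (U j))
    (hdisj : ∀ i j, i ≠ j → Disjoint (U i) (U j))
    (hconst : ∀ j, ∃ c : ℂ, ∀ z ∈ U j, evalC f z = c) :
    (∃ q : MvPolynomial (Fin n) ℝ, InPre g q ∧
      ∀ x : Fin n → ℝ, (fun i => (x i : ℂ)) ∈ ⋃ j, U j → eval x (f - q) = 0) ∧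
    (ArchCond g → ∃ q : MvPolynomial (Fin n) ℝ, InQM g q ∧
      ∀ x : Fin n → ℝ, (fun i => (x i : ℂ)) ∈ ⋃ j, U j → eval x (f - q) = 0) := by
  refine ⟨?_, fun hA => ?_⟩
  · exact exists_mem_eq_on_iUnion hf hU hdisj hconst (isQuadraticModule_preordering g)
      fun _ h => exists_mem_preordering_eq_neg_one g h
  · exact exists_mem_eq_on_iUnion hf hU hdisj hconst (isQuadraticModule_quadraticModule g)
      fun _ h => exists_mem_quadraticModule_eq_neg_one g h hA
end
end

section
/- Let f, g_1, …, g_m ∈ ℝ[x] with g = (g_1,…,g_m). If the image f(C(g)) := {f(x) : x ∈ C(g)} is a finite set, then the image {f(x) : (x, λ̄) ∈ V(h_FJ)} of V(h_FJ) under f is also a finite set. -/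
open MvPolynomial

noncomputable section

/-- The set of critical points `C(g)`. -/
def Cset {n m : ℕ} (g : Fin m → MvPolynomial (Fin n) ℝ) : Set (Fin n → ℝ) :=
  {x | ∃ lam : Fin m → ℝ, lam ≠ 0 ∧
    (∀ i, ∑ j, lam j * eval x (pderiv i (g j)) = 0) ∧
    (∀ j, lam j * eval x (g j) = 0)}

/-- The real variety `V(h_FJ)` of the Fritz John system attached to `f` and `g`. -/
def VFJ {n m : ℕ} (f : MvPolynomial (Fin n) ℝ) (g : Fin m → MvPolynomial (Fin n) ℝ) :
    Set ((Fin n → ℝ) × (Fin (m + 1) → ℝ)) :=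
  {p | (∀ i, p.2 0 * eval p.1 (pderiv i f) = ∑ j, p.2 j.succ * eval p.1 (pderiv i (g j)))
    ∧ (∀ j, p.2 j.succ * eval p.1 (g j) = 0)
    ∧ (∑ j, p.2 j ^ 2 = 1)}

open scoped TensorProduct

/-- In characteristic zero, an element of a finitely generated field extension whose universal
differential vanishes is algebraic over the base field. -/
theorem isAlgebraic_of_kaehlerDifferential_D_eq_zero {K L : Type*} [Field K] [CharZero K] [Field L]
    [Algebra K L] [Algebra.EssFiniteType K L] {x : L} (hx : KaehlerDifferential.D K L x = 0) :
    IsAlgebraic K x := by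
  let E := IntermediateField.adjoin K {x}
  have : CharZero E := charZero_of_injective_algebraMap (algebraMap K E).injective
  have : Algebra.EssFiniteType E L := .of_comp K E L
  have : Algebra.EssFiniteType K E :=
    IntermediateField.essFiniteType_iff.mpr
      (IntermediateField.fg_adjoin_of_finite (Set.finite_singleton x))
  have hinj : Function.Injective (KaehlerDifferential.mapBaseChange K E L) := by
    rw [injective_iff_map_eq_zero]
    intro y hy
    obtain ⟨z, rfl⟩ := (Algebra.H1Cotangent.exact_δ_mapBaseChange K E L y).mp hy
    rw [Subsingleton.elim z 0, map_zero]
  have hD : ∀ e ∈ E, KaehlerDifferential.D K L e = 0 := by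
    intro e he
    induction he using IntermediateField.adjoin_induction with
    | mem y hy => rwa [Set.mem_singleton_iff.mp hy]
    | algebraMap y => exact Derivation.map_algebraMap _ y
    | add y z _ _ hy hz => rw [map_add, hy, hz, add_zero]
    | inv y _ hy => rw [Derivation.leibniz_inv, hy, smul_zero]
    | mul y z _ _ hy hz => rw [Derivation.leibniz, hy, hz, smul_zero, smul_zero, add_zero]
  have hDE : ∀ e : E, KaehlerDifferential.D K E e = 0 := by
    intro e
    have h : (1 : L) ⊗ₜ[E] KaehlerDifferential.D K E e = 0 := by
      apply hinj
      rw [map_zero, KaehlerDifferential.mapBaseChange_tmul, KaehlerDifferential.map_D, one_smul]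
      exact hD _ e.2
    have : Module.Free E L := .of_divisionRing E L
    exact (Module.FaithfullyFlat.one_tmul_eq_zero_iff E _ _).mp h
  have : Algebra.FormallyUnramified K E := by
    refine ⟨?_⟩
    rw [← Submodule.subsingleton_iff E, ← subsingleton_iff_bot_eq_top,
      ← KaehlerDifferential.span_range_derivation, eq_comm, Submodule.span_eq_bot]
    rintro _ ⟨e, rfl⟩
    exact hDE e
  have := Algebra.FormallyUnramified.isSeparable K E
  exact (isAlgebraic_algebraMap_iff (algebraMap E L).injective).mpr
    (Algebra.IsAlgebraic.isAlgebraic (⟨x, IntermediateField.mem_adjoin_simple_self K x⟩ : E))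

theorem Derivation.map_mvPolynomial_aeval {σ K A M : Type*} [Fintype σ] [CommRing K] [CommRing A]
    [Algebra K A] [AddCommGroup M] [Module K M] [Module A M] (D : Derivation K A M) (x : σ → A)
    (p : MvPolynomial σ K) :
    D (aeval x p) = ∑ i, aeval x (pderiv i p) • D (x i) := by
  classical
  induction p using MvPolynomial.induction_on with
  | C a => simp [MvPolynomial.algHom_C]
  | add p q hp hq => simp [hp, hq, add_smul, Finset.sum_add_distrib]
  | mul_X p j hp =>
    simp only [map_mul, aeval_X, Derivation.leibniz, hp, pderiv_X, smul_eq_mul, map_add, add_smul,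
      Finset.sum_add_distrib, Finset.smul_sum, smul_smul]
    congr 1
    rw [Finset.sum_eq_single j]
    · simp
    · intro i _ hij
      simp [hij.symm]
    · simp

/-- At a Karush–Kuhn–Tucker point over a finitely generated field extension of a field of
characteristic zero, the value of the objective is algebraic. -/
theorem isAlgebraic_aeval_of_kkt {K L σ τ : Type*} [Field K] [CharZero K] [Field L] [Algebra K L]
    [Algebra.EssFiniteType K L] [Fintype σ] [Fintype τ] (f : MvPolynomial σ K)
    (g : τ → MvPolynomial σ K) (x : σ → L) (μ : τ → L)
    (hstat : ∀ i, aeval x (pderiv i f) = ∑ j, μ j * aeval x (pderiv i (g j)))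
    (hcompl : ∀ j, μ j * aeval x (g j) = 0) :
    IsAlgebraic K (aeval x f) := by
  apply isAlgebraic_of_kaehlerDifferential_D_eq_zero
  have hg : ∀ j, μ j • KaehlerDifferential.D K L (aeval x (g j)) = 0 := by
    intro j
    rcases mul_eq_zero.mp (hcompl j) with h | h <;> simp [h]
  rw [Derivation.map_mvPolynomial_aeval]
  simp_rw [hstat, Finset.sum_smul, mul_smul]
  rw [Finset.sum_comm]
  simp_rw [← Finset.smul_sum, ← Derivation.map_mvPolynomial_aeval, hg, Finset.sum_const_zero]

/-- In a Noetherian algebra, an element that is algebraic modulo every prime containing `I` is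
annihilated by a nonzero polynomial modulo the radical of `I`. -/
theorem exists_aeval_mem_radical {K R : Type*} [Field K] [CommRing R] [Algebra K R]
    [IsNoetherianRing R] (I : Ideal R) (a : R)
    (h : ∀ p : Ideal R, p.IsPrime → I ≤ p → IsAlgebraic K (Ideal.Quotient.mk p a)) :
    ∃ P : Polynomial K, P ≠ 0 ∧ Polynomial.aeval a P ∈ I.radical := by
  have hex : ∀ p : I.minimalPrimes, ∃ P : Polynomial K, P ≠ 0 ∧ Polynomial.aeval a P ∈ p.1 := by
    intro p
    obtain ⟨P, hP, hPa⟩ := h p.1 p.2.1.1 p.2.1.2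
    refine ⟨P, hP, Ideal.Quotient.eq_zero_iff_mem.mp ?_⟩
    rw [← hPa]
    exact (Polynomial.aeval_algHom_apply (Ideal.Quotient.mkₐ K p.1) a P).symm
  choose P hP hPa using hex
  have := (Ideal.finite_minimalPrimes_of_isNoetherianRing R I).fintype
  refine ⟨∏ p, P p, Finset.prod_ne_zero_iff.mpr fun p _ => hP p, ?_⟩
  rw [← Ideal.sInf_minimalPrimes, Ideal.mem_sInf]
  intro p hp
  rw [map_prod]
  exact Ideal.mem_of_dvd p (Finset.dvd_prod_of_mem _ (Finset.mem_univ ⟨p, hp⟩)) (hPa ⟨p, hp⟩)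

/-- The values of a polynomial at the Karush–Kuhn–Tucker points of a polynomial program are
the roots of a single nonzero polynomial. -/
theorem exists_polynomial_eval_kkt {K σ τ : Type*} [Field K] [CharZero K] [Fintype σ] [Fintype τ]
    (f : MvPolynomial σ K) (g : τ → MvPolynomial σ K) :
    ∃ P : Polynomial K, P ≠ 0 ∧ ∀ (x : σ → K) (μ : τ → K),
      (∀ i, eval x (pderiv i f) = ∑ j, μ j * eval x (pderiv i (g j))) →
      (∀ j, μ j * eval x (g j) = 0) → P.eval (eval x f) = 0 := by
  let ι : MvPolynomial σ K →ₐ[K] MvPolynomial (σ ⊕ τ) K := rename Sum.inl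
  let A : σ → MvPolynomial (σ ⊕ τ) K := fun i =>
    ι (pderiv i f) - ∑ j, X (Sum.inr j) * ι (pderiv i (g j))
  let B : τ → MvPolynomial (σ ⊕ τ) K := fun j => X (Sum.inr j) * ι (g j)
  let I := Ideal.span (Set.range A ∪ Set.range B)
  obtain ⟨P, hP, hPI⟩ : ∃ P : Polynomial K, P ≠ 0 ∧ Polynomial.aeval (ι f) P ∈ I.radical := by
    apply exists_aeval_mem_radical
    intro p hp hIp
    let L := FractionRing (MvPolynomial (σ ⊕ τ) K ⧸ p)
    have : Algebra.EssFiniteType (MvPolynomial (σ ⊕ τ) K ⧸ p) L :=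
      .of_isLocalization L (nonZeroDivisors _)
    have : Algebra.EssFiniteType K L := .comp K (MvPolynomial (σ ⊕ τ) K ⧸ p) L
    let φ : MvPolynomial (σ ⊕ τ) K →ₐ[K] L :=
      (IsScalarTower.toAlgHom K (MvPolynomial (σ ⊕ τ) K ⧸ p) L).comp (Ideal.Quotient.mkₐ K p)
    have hφ : ∀ q ∈ I, φ q = 0 := by
      intro q hq
      have : Ideal.Quotient.mk p q = 0 := Ideal.Quotient.eq_zero_iff_mem.mpr (hIp hq)
      change algebraMap _ L (Ideal.Quotient.mk p q) = 0
      rw [this, map_zero]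
    have hφι : ∀ q, aeval (fun i => φ (X (Sum.inl i))) q = φ (ι q) := by
      intro q
      have : aeval (fun i => φ (X (Sum.inl i))) = φ.comp ι := by
        ext i
        simp [ι]
      rw [this, AlgHom.comp_apply]
    rw [← isAlgebraic_algebraMap_iff (IsFractionRing.injective (MvPolynomial (σ ⊕ τ) K ⧸ p) L)]
    change IsAlgebraic K (φ (ι f))
    rw [← hφι]
    refine isAlgebraic_aeval_of_kkt f g _ (fun j => φ (X (Sum.inr j))) (fun i => ?_) fun j => ?_
    · simp_rw [hφι]
      have := hφ (A i) (Ideal.subset_span (.inl ⟨i, rfl⟩))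
      simpa only [A, map_sub, map_sum, map_mul, sub_eq_zero] using this
    · simp_rw [hφι]
      have := hφ (B j) (Ideal.subset_span (.inr ⟨j, rfl⟩))
      simpa only [B, map_mul] using this
  refine ⟨P, hP, fun x μ hstat hcompl => ?_⟩
  let ψ : MvPolynomial (σ ⊕ τ) K →ₐ[K] K := aeval (Sum.elim x μ)
  have hψι : ∀ q, ψ (ι q) = eval x q := by
    intro q
    simp [ψ, ι, aeval_rename, aeval_eq_eval]
  have hψX : ∀ j, ψ (X (Sum.inr j)) = μ j := by simp [ψ]
  have hI : I ≤ RingHom.ker ψ := by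
    rw [Ideal.span_le]
    rintro _ (⟨i, rfl⟩ | ⟨j, rfl⟩)
    · simp [A, hψι, hψX, hstat]
    · simpa [B, hψι, hψX] using hcompl j
  have := (RingHom.ker_isPrime ψ).radical_le_iff.mpr hI hPI
  rwa [RingHom.mem_ker, ← Polynomial.aeval_algHom_apply, hψι, Polynomial.aeval_def,
    Algebra.algebraMap_self, Polynomial.eval₂_id] at this

/-- If `f(C(g))` is a finite set, then the image of `V(h_FJ)` under `f` (evaluated at the
`x`-coordinates) is also finite. -/
theorem finite_image_VFJ {n m : ℕ} (f : MvPolynomial (Fin n) ℝ)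
    (g : Fin m → MvPolynomial (Fin n) ℝ)
    (hfin : ((fun x => eval x f) '' Cset g).Finite) :
    ((fun p : (Fin n → ℝ) × (Fin (m + 1) → ℝ) => eval p.1 f) '' VFJ f g).Finite := by
  obtain ⟨P, hP, hroot⟩ := exists_polynomial_eval_kkt f g
  refine (hfin.union (P.rootSet_finite ℝ)).subset ?_
  rintro _ ⟨⟨x, lam⟩, ⟨hstat, hcompl, hnorm⟩, rfl⟩
  dsimp only at hstat hcompl hnorm ⊢
  by_cases h0 : lam 0 = 0
  · refine .inl ⟨x, ⟨fun j => lam j.succ, ?_, fun i => ?_, hcompl⟩, rfl⟩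
    · intro hzero
      have hsucc : ∀ j : Fin m, lam j.succ = 0 := congrFun hzero
      simp [Fin.sum_univ_succ, h0, hsucc] at hnorm
    · rw [← hstat i, h0, zero_mul]
  · refine .inr ((Polynomial.mem_rootSet_of_ne hP).mpr ?_)
    rw [Polynomial.coe_aeval_eq_eval]
    refine hroot x (fun j => lam j.succ / lam 0) (fun i => ?_) fun j => ?_
    · simp_rw [div_mul_eq_mul_div]
      rw [← Finset.sum_div, ← hstat i, mul_div_cancel_left₀ _ h0]
    · rw [div_mul_eq_mul_div, hcompl j, zero_div]
end
end
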